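/- arXiv:2509.22514 — 2 statements merged into one kernel-verified Lean document; each statement's English description precedes it below -/
import Mathlib

section
/- Let K ∈ ℝ, N ∈ (1,∞), p ∈ (1,∞) and r ∈ (0, D_{K,N}). Then there exists a nonnegative admissible competitor φ attaining the infimum λ_p(K,N,r), i.e. φ : (0,r) → [0,∞) is locally absolutely continuous with 0 < ∫₀^r φ^p·h_{K,N} dt < ∞, lim_{t→r⁻} φ(t) = 0, and (∫₀^r |φ'|^p·h_{K,N} dt)/(∫₀^r φ^p·h_{K,N} dt) = λ_p(K,N,r). Moreover, the a.e.-defined function |φ'|^{p−2}·φ' admits a locally absolutely continuous representative w on (0,r) which satisfies, for almost every t ∈ (0,r), w'(t) + w(t)·(h_{K,N}'(t)/h_{K,N}(t)) = −λ_p(K,N,r)·|φ(t)|^{p−2}·φ(t). -/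
open Real MeasureTheory Filter Set
open scoped ENNReal NNReal Topology

/-- The one-dimensional `(K,N)`-model density `h_{K,N}`. -/
noncomputable def modelDensity (K N t : ℝ) : ℝ :=
  if 0 < K then Real.sin (Real.sqrt (K / (N - 1)) * t) ^ (N - 1)
  else if K = 0 then t ^ (N - 1)
  else Real.sinh (Real.sqrt (-K / (N - 1)) * t) ^ (N - 1)

/-- `φ` is locally absolutely continuous on `(0,r)` with (a.e.) derivative `dφ`:
`dφ` is locally integrable on `(0,r)` and the fundamental theorem of calculus holds. -/
def IsLocAC (r : ℝ) (φ dφ : ℝ → ℝ) : Prop :=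
  LocallyIntegrableOn dφ (Set.Ioo 0 r) ∧
  ∀ s t : ℝ, 0 < s → s ≤ t → t < r → φ t = φ s + ∫ u in s..t, dφ u

/-- `φ` (with derivative `dφ`) is an admissible competitor for the first Dirichlet
`p`-eigenvalue on the `(K,N)`-model interval `(0,r)`: locally absolutely continuous,
with `0 < ∫₀^r |φ|^p h_{K,N} < ∞` and `φ(t) → 0` as `t → r⁻`. -/
def IsAdmissible (K N p r : ℝ) (φ dφ : ℝ → ℝ) : Prop :=
  IsLocAC r φ dφ ∧
  0 < ∫⁻ t in Set.Ioo 0 r, ENNReal.ofReal (|φ t| ^ p * modelDensity K N t) ∧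
  (∫⁻ t in Set.Ioo 0 r, ENNReal.ofReal (|φ t| ^ p * modelDensity K N t)) < ⊤ ∧
  Filter.Tendsto φ (nhdsWithin r (Set.Iio r)) (nhds 0)

/-- The Rayleigh quotient `(∫₀^r |φ'|^p h_{K,N}) / (∫₀^r |φ|^p h_{K,N})`, valued in `[0,∞]`. -/
noncomputable def rayleighQuot (K N p r : ℝ) (φ dφ : ℝ → ℝ) : ℝ≥0∞ :=
  (∫⁻ t in Set.Ioo 0 r, ENNReal.ofReal (|dφ t| ^ p * modelDensity K N t)) /
    (∫⁻ t in Set.Ioo 0 r, ENNReal.ofReal (|φ t| ^ p * modelDensity K N t))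

/-- The first Dirichlet `p`-eigenvalue `λ_p(K,N,r)` of the `(K,N)`-model interval `(0,r)`. -/
noncomputable def lambdaP (K N p r : ℝ) : ℝ≥0∞ :=
  ⨅ (φ : ℝ → ℝ) (dφ : ℝ → ℝ) (_ : IsAdmissible K N p r φ dφ),
    rayleighQuot K N p r φ dφ

/-! ### The nonlinear integral operator -/

/-- The weighted mass `∫₀^s h f^q`. -/
noncomputable def weightedMass (h : ℝ → ℝ) (q : ℝ) (f : ℝ → ℝ≥0∞) (s : ℝ) : ℝ≥0∞ :=
  ∫⁻ u in Ioo 0 s, ENNReal.ofReal (h u) * f u ^ q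

/-- The slope at `s` of the solution of the Dirichlet problem with source `f`. -/
noncomputable def dirichletSlope (h : ℝ → ℝ) (q : ℝ) (f : ℝ → ℝ≥0∞) (s : ℝ) : ℝ≥0∞ :=
  (weightedMass h q f s / ENNReal.ofReal (h s)) ^ (1 / q)

/-- The solution operator `f ↦ ∫_t^r (h⁻¹ ∫₀^s h f^q)^{1/q} ds` of the Dirichlet problem. -/
noncomputable def dirichletSolution (h : ℝ → ℝ) (q r : ℝ) (f : ℝ → ℝ≥0∞) (t : ℝ) : ℝ≥0∞ :=
  ∫⁻ s in Ioo t r, dirichletSlope h q f s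

section Operator

variable {h : ℝ → ℝ} {q r C : ℝ} {f g : ℝ → ℝ≥0∞}

lemma weightedMass_mono_fun (hq : 0 < q) (hfg : f ≤ g) (s : ℝ) :
    weightedMass h q f s ≤ weightedMass h q g s := by
  unfold weightedMass
  gcongr with u
  exact hfg u

lemma monotone_weightedMass : Monotone (weightedMass h q f) := fun _ _ hst =>
  lintegral_mono_set (Ioo_subset_Ioo_right hst)

lemma dirichletSlope_mono_fun (hq : 0 < q) (hfg : f ≤ g) (s : ℝ) :
    dirichletSlope h q f s ≤ dirichletSlope h q g s := by
  unfold dirichletSlope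
  gcongr
  exact weightedMass_mono_fun hq hfg s

lemma measurable_dirichletSlope (hm : Measurable h) : Measurable (dirichletSlope h q f) :=
  (monotone_weightedMass.measurable.div hm.ennreal_ofReal).pow_const _

lemma dirichletSlope_of_nonpos (hq : 0 < q) {s : ℝ} (hs : s ≤ 0) : dirichletSlope h q f s = 0 := by
  simp [dirichletSlope, weightedMass, Ioo_eq_empty (not_lt.2 hs), hq]

lemma weightedMass_const_mul (hq : 0 < q) {c : ℝ≥0∞} (hc : c ≠ ⊤) (s : ℝ) :
    weightedMass h q (fun u => c * f u) s = c ^ q * weightedMass h q f s := by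
  unfold weightedMass
  rw [← lintegral_const_mul' _ _ (ENNReal.rpow_ne_top_of_nonneg hq.le hc)]
  refine lintegral_congr fun u => ?_
  rw [ENNReal.mul_rpow_of_nonneg _ _ hq.le]
  ring

lemma dirichletSlope_const_mul (hq : 0 < q) {c : ℝ≥0∞} (hc : c ≠ ⊤) (s : ℝ) :
    dirichletSlope h q (fun u => c * f u) s = c * dirichletSlope h q f s := by
  unfold dirichletSlope
  rw [weightedMass_const_mul hq hc, mul_div_assoc, ENNReal.mul_rpow_of_nonneg _ _ (by positivity),
    ← ENNReal.rpow_mul, mul_one_div_cancel hq.ne', ENNReal.rpow_one]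

lemma dirichletSolution_const_mul (hq : 0 < q) {c : ℝ≥0∞} (hc : c ≠ ⊤) (t : ℝ) :
    dirichletSolution h q r (fun u => c * f u) t = c * dirichletSolution h q r f t := by
  unfold dirichletSolution
  rw [← lintegral_const_mul' _ _ hc]
  simp_rw [dirichletSlope_const_mul hq hc]

lemma dirichletSolution_mono_fun (hq : 0 < q) (hfg : f ≤ g) (t : ℝ) :
    dirichletSolution h q r f t ≤ dirichletSolution h q r g t :=
  lintegral_mono fun s => dirichletSlope_mono_fun hq hfg s

lemma antitone_dirichletSolution : Antitone (dirichletSolution h q r f) := fun _ _ hst =>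
  lintegral_mono_set (Ioo_subset_Ioo_left hst)

lemma dirichletSolution_le_zero (hq : 0 < q) (t : ℝ) :
    dirichletSolution h q r f t ≤ dirichletSolution h q r f 0 := by
  rcases le_total 0 t with ht | ht
  · exact antitone_dirichletSolution ht
  · unfold dirichletSolution
    rw [← lintegral_indicator measurableSet_Ioo, ← lintegral_indicator measurableSet_Ioo]
    refine lintegral_mono fun s => ?_
    rcases le_or_gt s 0 with hs | hs
    · simp [indicator, dirichletSlope_of_nonpos hq hs]
    · simp only [indicator, mem_Ioo]
      split_ifs with h1 h2 <;> simp_all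

lemma weightedMass_le (hC : 0 ≤ C) (hq : 0 < q)
    (hmono : ∀ u s, 0 < u → u ≤ s → s < r → h u ≤ C * h s) {M : ℝ≥0∞} (hf : ∀ u, f u ≤ M)
    {s : ℝ} (hsr : s < r) :
    weightedMass h q f s ≤ ENNReal.ofReal (C * r) * M ^ q * ENNReal.ofReal (h s) := by
  rcases le_or_gt s 0 with hs | hs
  · simp [weightedMass, Ioo_eq_empty (not_lt.2 hs)]
  calc weightedMass h q f s
      ≤ ∫⁻ _ in Ioo 0 s, ENNReal.ofReal (C * h s) * M ^ q := by
        refine setLIntegral_mono measurable_const fun u hu => ?_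
        gcongr
        · exact hmono u s hu.1 hu.2.le hsr
        · exact hf u
    _ = ENNReal.ofReal (C * s) * M ^ q * ENNReal.ofReal (h s) := by
        rw [setLIntegral_const, Real.volume_Ioo, sub_zero, ENNReal.ofReal_mul hC,
          ENNReal.ofReal_mul hC]
        ring
    _ ≤ _ := by gcongr

lemma dirichletSlope_le (hC : 0 ≤ C) (hq : 0 < q)
    (hmono : ∀ u s, 0 < u → u ≤ s → s < r → h u ≤ C * h s) {M : ℝ≥0∞} (hf : ∀ u, f u ≤ M)
    {s : ℝ} (hsr : s < r) :
    dirichletSlope h q f s ≤ M * ENNReal.ofReal (C * r) ^ (1 / q) := by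
  unfold dirichletSlope
  calc (weightedMass h q f s / ENNReal.ofReal (h s)) ^ (1 / q)
      ≤ (ENNReal.ofReal (C * r) * M ^ q) ^ (1 / q) := by
        gcongr
        exact ENNReal.div_le_of_le_mul (weightedMass_le hC hq hmono hf hsr)
    _ = _ := by
        rw [ENNReal.mul_rpow_of_nonneg _ _ (by positivity), ← ENNReal.rpow_mul,
          mul_one_div_cancel hq.ne', ENNReal.rpow_one, mul_comm]

lemma dirichletSolution_le_add (hC : 0 ≤ C) (hq : 0 < q)
    (hmono : ∀ u s, 0 < u → u ≤ s → s < r → h u ≤ C * h s) {M : ℝ≥0∞} (hf : ∀ u, f u ≤ M)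
    {s t : ℝ} (htr : t ≤ r) :
    dirichletSolution h q r f s ≤ M * ENNReal.ofReal (C * r) ^ (1 / q) * ENNReal.ofReal (t - s) +
      dirichletSolution h q r f t := by
  unfold dirichletSolution
  have hsub : Ioo s r ⊆ Ioc s t ∪ Ioo t r := fun u hu => by
    rcases le_or_gt u t with h' | h'
    · exact Or.inl ⟨hu.1, h'⟩
    · exact Or.inr ⟨h', hu.2⟩
  refine (lintegral_mono_set hsub).trans ((lintegral_union_le _ _ _).trans ?_)
  gcongr
  rw [← setLIntegral_congr (Ioo_ae_eq_Ioc (a := s) (b := t)), ← Real.volume_Ioo,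
    ← setLIntegral_const]
  exact setLIntegral_mono measurable_const fun u hu =>
    dirichletSlope_le hC hq hmono hf (hu.2.trans_le htr)

lemma dirichletSolution_apply_right : dirichletSolution h q r f r = 0 := by
  simp [dirichletSolution]

lemma dirichletSolution_le (hC : 0 ≤ C) (hq : 0 < q)
    (hmono : ∀ u s, 0 < u → u ≤ s → s < r → h u ≤ C * h s) {M : ℝ≥0∞} (hf : ∀ u, f u ≤ M)
    (t : ℝ) :
    dirichletSolution h q r f t ≤ M * (ENNReal.ofReal (C * r) ^ (1 / q) * ENNReal.ofReal r) := by
  refine (dirichletSolution_le_zero hq t).trans ?_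
  simpa [dirichletSolution_apply_right, mul_assoc] using
    dirichletSolution_le_add (s := 0) hC hq hmono hf le_rfl

lemma weightedMass_pos (hm : Measurable h) (hpos : ∀ t ∈ Ioo 0 r, 0 < h t) (hq : 0 < q)
    (hf : Measurable f) {δ s : ℝ} (hδ : 0 < δ) (hfδ : ∀ u ∈ Ioo 0 δ, f u ≠ 0) (hs : s ∈ Ioo 0 r) :
    0 < weightedMass h q f s := by
  unfold weightedMass
  have hmeas : Measurable fun u => ENNReal.ofReal (h u) * f u ^ q :=
    hm.ennreal_ofReal.mul (hf.pow_const q)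
  rw [setLIntegral_pos_iff hmeas]
  have hsub : Ioo 0 (min δ s) ⊆
      Function.support (fun u => ENNReal.ofReal (h u) * f u ^ q) ∩ Ioo 0 s := by
    intro u hu
    have hus : u < s := hu.2.trans_le (min_le_right _ _)
    refine ⟨?_, hu.1, hus⟩
    have h1 := hpos u ⟨hu.1, hus.trans hs.2⟩
    have h2 := hfδ u ⟨hu.1, hu.2.trans_le (min_le_left _ _)⟩
    simp [h1, h2, hq.not_gt]
  refine lt_of_lt_of_le ?_ (measure_mono hsub)
  simp [hδ, hs.1]

lemma dirichletSlope_pos (hm : Measurable h) (hpos : ∀ t ∈ Ioo 0 r, 0 < h t) (hq : 0 < q)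
    (hf : Measurable f) {δ s : ℝ} (hδ : 0 < δ) (hfδ : ∀ u ∈ Ioo 0 δ, f u ≠ 0) (hs : s ∈ Ioo 0 r) :
    0 < dirichletSlope h q f s :=
  ENNReal.rpow_pos_of_nonneg (ENNReal.div_pos (weightedMass_pos hm hpos hq hf hδ hfδ hs).ne'
    ENNReal.ofReal_ne_top) (by positivity)

lemma dirichletSolution_pos (hm : Measurable h) (hpos : ∀ t ∈ Ioo 0 r, 0 < h t) (hq : 0 < q)
    (hf : Measurable f) {δ t : ℝ} (hδ : 0 < δ) (hfδ : ∀ u ∈ Ioo 0 δ, f u ≠ 0) (ht0 : 0 ≤ t)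
    (htr : t < r) :
    0 < dirichletSolution h q r f t := by
  unfold dirichletSolution
  rw [setLIntegral_pos_iff (measurable_dirichletSlope hm)]
  have hsub : Ioo t r ⊆ Function.support (dirichletSlope h q f) ∩ Ioo t r := fun s hs =>
    ⟨(dirichletSlope_pos hm hpos hq hf hδ hfδ ⟨ht0.trans_lt hs.1, hs.2⟩).ne', hs⟩
  refine lt_of_lt_of_le ?_ (measure_mono hsub)
  simp [htr]

/-- Continuity of the solution operator under bounded pointwise convergence. -/
lemma tendsto_dirichletSolution (hC : 0 ≤ C) (hq : 0 < q) (hm : Measurable h)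
    (hpos : ∀ t ∈ Ioo 0 r, 0 < h t)
    (hmono : ∀ u s, 0 < u → u ≤ s → s < r → h u ≤ C * h s)
    {F : ℕ → ℝ → ℝ≥0∞} (hF : ∀ n, Measurable (F n)) (hF1 : ∀ n u, F n u ≤ 1)
    (hlim : ∀ u ∈ Ioo 0 r, Tendsto (fun n => F n u) atTop (𝓝 (f u))) {t : ℝ} (ht : 0 ≤ t) :
    Tendsto (fun n => dirichletSolution h q r (F n) t) atTop
      (𝓝 (dirichletSolution h q r f t)) := by
  have hslope : ∀ s ∈ Ioo 0 r, Tendsto (fun n => dirichletSlope h q (F n) s) atTop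
      (𝓝 (dirichletSlope h q f s)) := by
    intro s hs
    have hmass : Tendsto (fun n => weightedMass h q (F n) s) atTop
        (𝓝 (weightedMass h q f s)) := by
      refine tendsto_lintegral_of_dominated_convergence (fun u => ENNReal.ofReal (h u))
        (fun n => hm.ennreal_ofReal.mul ((hF n).pow_const q)) (fun n => ?_) ?_ ?_
      · refine Eventually.of_forall fun u => ?_
        exact mul_le_of_le_one_right' (ENNReal.rpow_le_one (hF1 n u) hq.le)
      · have := weightedMass_le (f := fun _ => 1) hC hq hmono (fun _ => le_rfl) hs.2
        simp only [weightedMass, ENNReal.one_rpow, mul_one] at this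
        exact ne_top_of_le_ne_top (by finiteness) this
      · refine (ae_restrict_iff' measurableSet_Ioo).2 (Eventually.of_forall fun u hu => ?_)
        refine ENNReal.Tendsto.const_mul ?_ (Or.inr ENNReal.ofReal_ne_top)
        exact (ENNReal.continuous_rpow_const.tendsto _).comp (hlim u ⟨hu.1, hu.2.trans hs.2⟩)
    refine (ENNReal.continuous_rpow_const.tendsto _).comp ?_
    exact ENNReal.Tendsto.div_const hmass (Or.inr (by simpa using hpos s hs))
  refine tendsto_lintegral_of_dominated_convergence
    (fun _ => 1 * ENNReal.ofReal (C * r) ^ (1 / q))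
    (fun n => measurable_dirichletSlope hm) (fun n => ?_) ?_ ?_
  · exact (ae_restrict_iff' measurableSet_Ioo).2 (Eventually.of_forall fun s hs =>
      dirichletSlope_le hC hq hmono (hF1 n) hs.2)
  · rw [setLIntegral_const, Real.volume_Ioo]
    have : ENNReal.ofReal (C * r) ^ (1 / q) ≠ ⊤ :=
      ENNReal.rpow_ne_top_of_nonneg (by positivity) ENNReal.ofReal_ne_top
    finiteness
  · exact (ae_restrict_iff' measurableSet_Ioo).2 (Eventually.of_forall fun s hs =>
      hslope s ⟨ht.trans_lt hs.1, hs.2⟩)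

end Operator

/-! ### The least solution of `f = 1 + μ S f` and its blow-up -/

/-- The monotone map `f ↦ 1 + μ S f`. -/
noncomputable def leastSolutionMap (h : ℝ → ℝ) {q : ℝ} (r : ℝ) (hq : 0 < q) (μ : ℝ≥0) :
    (ℝ → ℝ≥0∞) →o (ℝ → ℝ≥0∞) where
  toFun f t := 1 + μ * dirichletSolution h q r f t
  monotone' _ _ hfg t := by
    dsimp only
    gcongr
    exact dirichletSolution_mono_fun hq hfg t

/-- The least solution of `f = 1 + μ S f`. -/
noncomputable def leastSolution (h : ℝ → ℝ) {q : ℝ} (r : ℝ) (hq : 0 < q) (μ : ℝ≥0) : ℝ → ℝ≥0∞ :=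
  (leastSolutionMap h r hq μ).lfp

section LeastSolution

variable {h : ℝ → ℝ} {q r C : ℝ}

lemma leastSolution_eq (hq : 0 < q) (μ : ℝ≥0) (t : ℝ) :
    leastSolution h r hq μ t = 1 + μ * dirichletSolution h q r (leastSolution h r hq μ) t :=
  (congrFun (leastSolutionMap h r hq μ).map_lfp t).symm

lemma leastSolution_le (hq : 0 < q) {μ : ℝ≥0} {f : ℝ → ℝ≥0∞}
    (hf : ∀ t, 1 + μ * dirichletSolution h q r f t ≤ f t) : leastSolution h r hq μ ≤ f :=
  (leastSolutionMap h r hq μ).lfp_le hf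

lemma antitone_leastSolution (hq : 0 < q) (μ : ℝ≥0) : Antitone (leastSolution h r hq μ) := fun s t hst => by
  rw [leastSolution_eq, leastSolution_eq hq μ s]
  gcongr
  exact antitone_dirichletSolution hst

lemma leastSolution_le_zero (hq : 0 < q) (μ : ℝ≥0) (t : ℝ) :
    leastSolution h r hq μ t ≤ leastSolution h r hq μ 0 := by
  rw [leastSolution_eq, leastSolution_eq hq μ 0]
  gcongr
  exact dirichletSolution_le_zero hq t

lemma one_le_leastSolution (hq : 0 < q) (μ : ℝ≥0) (t : ℝ) : 1 ≤ leastSolution h r hq μ t := by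
  rw [leastSolution_eq]
  exact le_self_add

/-- The parameters `μ` for which `f = 1 + μ S f` has a bounded solution. -/
def boundedParameters (h : ℝ → ℝ) {q : ℝ} (r : ℝ) (hq : 0 < q) : Set ℝ≥0 :=
  {μ | leastSolution h r hq μ 0 < ⊤}

lemma zero_mem_boundedParameters (hq : 0 < q) : 0 ∈ boundedParameters h r hq := by
  have : leastSolution h r hq 0 0 = 1 := by rw [leastSolution_eq]; simp
  simp [boundedParameters, this]

lemma bddAbove_boundedParameters (hr : 0 < r) (hq : 0 < q) (hm : Measurable h)
    (hpos : ∀ t ∈ Ioo 0 r, 0 < h t) : BddAbove (boundedParameters h r hq) := by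
  set e : ℝ → ℝ≥0∞ := (Iic (r / 2)).indicator 1 with he
  have hem : Measurable e := measurable_one.indicator measurableSet_Iic
  set c := dirichletSolution h q r e (r / 2) with hc
  have hcpos : 0 < c := by
    refine dirichletSolution_pos hm hpos hq hem (half_pos hr) (fun u hu => ?_) (by positivity)
      (by linarith)
    simp [he, hu.2.le]
  refine ⟨(c⁻¹).toNNReal, fun μ hμ => ?_⟩
  have hfin : leastSolution h r hq μ (r / 2) ≠ ⊤ :=
    ((leastSolution_le_zero hq μ _).trans_lt hμ).ne
  set m := leastSolution h r hq μ (r / 2) with hmdef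
  have hle : (fun u => m * e u) ≤ leastSolution h r hq μ := fun u => by
    by_cases hu : u ≤ r / 2
    · simpa [he, indicator, hu] using antitone_leastSolution hq μ hu
    · simp [he, hu]
  have key : 1 + μ * (m * c) ≤ m := by
    conv_rhs => rw [hmdef, leastSolution_eq]
    gcongr
    rw [hc, ← dirichletSolution_const_mul hq hfin]
    exact dirichletSolution_mono_fun hq hle _
  have hlt : μ * c < 1 := by
    by_contra! hcon
    have : 1 + m ≤ m := calc
      1 + m ≤ 1 + (μ * c) * m := by gcongr; exact le_mul_of_one_le_left' hcon
      _ = 1 + μ * (m * c) := by ring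
      _ ≤ m := key
    exact absurd this (not_le.2 (by rw [add_comm]; exact ENNReal.lt_add_right hfin one_ne_zero))
  have h1 : (μ : ℝ≥0∞) ≤ c⁻¹ := by
    rw [ENNReal.le_inv_iff_mul_le]
    exact hlt.le
  exact (ENNReal.le_toNNReal_of_coe_le h1 (ENNReal.inv_ne_top.2 hcpos.ne'))

lemma add_mem_boundedParameters (hC : 0 ≤ C) (hq : 0 < q)
    (hmono : ∀ u s, 0 < u → u ≤ s → s < r → h u ≤ C * h s) {μ ε : ℝ≥0}
    (hμ : μ ∈ boundedParameters h r hq)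
    (hε : ε * (2 * leastSolution h r hq μ 0 *
      (ENNReal.ofReal (C * r) ^ (1 / q) * ENNReal.ofReal r)) ≤ 1) :
    μ + ε ∈ boundedParameters h r hq := by
  set f : ℝ → ℝ≥0∞ := fun t => 2 * leastSolution h r hq μ t with hf
  have hle : leastSolution h r hq (μ + ε) ≤ f := by
    refine leastSolution_le hq fun t => ?_
    have h1 : dirichletSolution h q r f t ≤ 2 * leastSolution h r hq μ 0 *
        (ENNReal.ofReal (C * r) ^ (1 / q) * ENNReal.ofReal r) :=
      dirichletSolution_le hC hq hmono
        (fun u => mul_le_mul_right (leastSolution_le_zero hq μ u) _) t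
    calc 1 + ((μ + ε : ℝ≥0) : ℝ≥0∞) * dirichletSolution h q r f t
        = 1 + (ε * dirichletSolution h q r f t + μ * dirichletSolution h q r f t) := by
          push_cast; ring
      _ ≤ 1 + (1 + μ * dirichletSolution h q r f t) := by
          gcongr
          exact le_trans (by gcongr) hε
      _ = f t := by
          rw [hf, dirichletSolution_const_mul hq (by simp)]
          conv_rhs => dsimp only; rw [leastSolution_eq]
          ring
  refine (hle 0).trans_lt ?_
  exact ENNReal.mul_lt_top (by simp) hμ

/-- There are normalised solutions of `f = ε + μ S f` with `ε → 0` and `μ` convergent. -/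
lemma exists_approximate_eigenfunctions (hC : 0 < C) (hr : 0 < r) (hq : 0 < q) (hm : Measurable h)
    (hpos : ∀ t ∈ Ioo 0 r, 0 < h t)
    (hmono : ∀ u s, 0 < u → u ≤ s → s < r → h u ≤ C * h s) :
    ∃ (μ : ℝ≥0) (ν : ℕ → ℝ≥0) (ε : ℕ → ℝ≥0∞) (f : ℕ → ℝ → ℝ≥0∞),
      (∀ n, ν n ≤ μ) ∧ Tendsto ν atTop (𝓝 μ) ∧ Tendsto ε atTop (𝓝 0) ∧
      (∀ n, Antitone (f n)) ∧ (∀ n t, f n t ≤ 1) ∧ (∀ n, f n 0 = 1) ∧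
      ∀ n t, f n t = ε n + ν n * dirichletSolution h q r (f n) t := by
  have hbdd := bddAbove_boundedParameters hr hq hm hpos
  obtain ⟨ν, -, hν, hνmem⟩ := exists_seq_tendsto_sSup ⟨0, zero_mem_boundedParameters hq⟩ hbdd
  set μ := sSup (boundedParameters h r hq)
  have hνle : ∀ n, ν n ≤ μ := fun n => le_csSup hbdd (hνmem n)
  set M : ℕ → ℝ≥0∞ := fun n => leastSolution h r hq (ν n) 0 with hM
  have hMtop : ∀ n, M n ≠ ⊤ := fun n => (hνmem n).ne
  have hM1 : ∀ n, 1 ≤ M n := fun n => one_le_leastSolution hq _ _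
  have hM0 : ∀ n, M n ≠ 0 := fun n => (zero_lt_one.trans_le (hM1 n)).ne'
  have hMitop : ∀ n, (M n)⁻¹ ≠ ⊤ := fun n => ENNReal.inv_ne_top.2 (hM0 n)
  set D : ℝ≥0∞ := ENNReal.ofReal (C * r) ^ (1 / q) * ENNReal.ofReal r with hD
  have hDtop : D ≠ ⊤ := ENNReal.mul_ne_top
    (ENNReal.rpow_ne_top_of_nonneg (by positivity) ENNReal.ofReal_ne_top) ENNReal.ofReal_ne_top
  have hD0 : D ≠ 0 := by
    have : ENNReal.ofReal (C * r) ^ (1 / q) ≠ 0 :=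
      (ENNReal.rpow_pos_of_nonneg (by simpa using mul_pos hC hr) (by positivity)).ne'
    simp only [hD, ne_eq, mul_eq_zero, this, false_or]
    simpa using hr
  have hgap : ∀ n, (M n)⁻¹ ≤ 2 * D * ((μ : ℝ≥0∞) - ν n) := by
    intro n
    have hne : 2 * M n * D ≠ 0 := by simp [hM0 n, hD0]
    have hnt : 2 * M n * D ≠ ⊤ := by finiteness [hMtop n]
    have hitop : (2 * M n * D)⁻¹ ≠ ⊤ := ENNReal.inv_ne_top.2 hne
    have hmem : ν n + (2 * M n * D)⁻¹.toNNReal ∈ boundedParameters h r hq := by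
      refine add_mem_boundedParameters hC.le hq hmono (hνmem n) ?_
      rw [ENNReal.coe_toNNReal hitop]
      exact (ENNReal.inv_mul_cancel hne hnt).le
    have hle : ((ν n + (2 * M n * D)⁻¹.toNNReal : ℝ≥0) : ℝ≥0∞) ≤ μ :=
      ENNReal.coe_le_coe.2 (le_csSup hbdd hmem)
    rw [ENNReal.coe_add, ENNReal.coe_toNNReal hitop] at hle
    have hle2 : (2 * M n * D)⁻¹ ≤ (μ : ℝ≥0∞) - ν n :=
      ENNReal.le_sub_of_add_le_left ENNReal.coe_ne_top hle
    calc (M n)⁻¹ = 2 * D * (2 * M n * D)⁻¹ := by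
          have : 2 * M n * D = 2 * D * M n := by ring
          rw [this, ENNReal.mul_inv (Or.inr (hMtop n)) (Or.inr (hM0 n)), ← mul_assoc,
            ENNReal.mul_inv_cancel (by simp [hD0]) (by finiteness), one_mul]
      _ ≤ _ := by gcongr
  refine ⟨μ, ν, fun n => (M n)⁻¹, fun n t => (M n)⁻¹ * leastSolution h r hq (ν n) t, hνle, hν, ?_,
    ?_, ?_, ?_, ?_⟩
  · have h1 : Tendsto (fun n => 2 * D * ((μ : ℝ≥0∞) - ν n)) atTop
        (𝓝 (2 * D * ((μ : ℝ≥0∞) - μ))) := by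
      refine ENNReal.Tendsto.const_mul ?_ (Or.inr (by finiteness))
      exact ENNReal.Tendsto.sub tendsto_const_nhds (ENNReal.tendsto_coe.2 hν) (Or.inl (by simp))
    rw [tsub_self, mul_zero] at h1
    exact tendsto_of_tendsto_of_tendsto_of_le_of_le tendsto_const_nhds h1
      (fun _ => zero_le) hgap
  · intro n s t hst
    exact mul_le_mul_right (antitone_leastSolution hq _ hst) _
  · intro n t
    rw [← ENNReal.inv_mul_cancel (hM0 n) (hMtop n)]
    exact mul_le_mul_right (leastSolution_le_zero hq _ t) _
  · intro n
    exact ENNReal.inv_mul_cancel (hM0 n) (hMtop n)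
  · intro n t
    rw [dirichletSolution_const_mul hq (hMitop n)]
    conv_lhs => dsimp only; rw [leastSolution_eq]
    ring

end LeastSolution

/-! ### Existence of an eigenfunction of the solution operator -/

/-- A sequence of uniformly Lipschitz functions with values in `[0,1]` on a compact interval has a
pointwise convergent subsequence. -/
lemma exists_subseq_tendsto_of_lipschitz {a b : ℝ} {K : ℝ≥0} {F : ℕ → ℝ → ℝ}
    (hF : ∀ n, LipschitzOnWith K (F n) (Icc a b)) (h01 : ∀ n, ∀ t ∈ Icc a b, F n t ∈ Icc (0 : ℝ) 1) :
    ∃ (f : ℝ → ℝ) (k : ℕ → ℕ), StrictMono k ∧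
      ∀ t ∈ Icc a b, Tendsto (fun n => F (k n) t) atTop (𝓝 (f t)) := by
  let G : ℕ → BoundedContinuousFunction (Icc a b) ℝ := fun n =>
    BoundedContinuousFunction.mkOfCompact ⟨(Icc a b).domRestrict (F n),
      ((hF n).continuousOn).domRestrict⟩
  have hcomp : IsCompact (closure (range G)) := by
    refine BoundedContinuousFunction.arzela_ascoli (Icc (0 : ℝ) 1) isCompact_Icc _ ?_ ?_
    · rintro _ x ⟨n, rfl⟩
      exact h01 n x x.2
    · refine LipschitzWith.uniformEquicontinuous _ K ?_ |>.equicontinuous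
      rintro ⟨_, n, rfl⟩
      exact lipschitzOnWith_iff_restrict.1 (hF n)
  obtain ⟨g, -, k, hk, hg⟩ := hcomp.tendsto_subseq (x := G) fun n => subset_closure ⟨n, rfl⟩
  refine ⟨fun t => if ht : t ∈ Icc a b then g ⟨t, ht⟩ else 0, k, hk, fun t ht => ?_⟩
  have h1 := ((BoundedContinuousFunction.evalCLM ℝ (⟨t, ht⟩ : Icc a b)).continuous.tendsto g).comp hg
  simp only [ht, dite_true]
  exact h1

/-- The solution operator has a normalised eigenfunction. -/
lemma exists_dirichletSolution_eigenfunction {h : ℝ → ℝ} {q r C : ℝ} (hC : 0 < C) (hr : 0 < r)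
    (hq : 0 < q) (hm : Measurable h) (hpos : ∀ t ∈ Ioo 0 r, 0 < h t)
    (hmono : ∀ u s, 0 < u → u ≤ s → s < r → h u ≤ C * h s) :
    ∃ (μ : ℝ≥0) (f : ℝ → ℝ≥0∞), f 0 = 1 ∧ (∀ t, f t ≤ 1) ∧
      ∀ t, f t = μ * dirichletSolution h q r f t := by
  obtain ⟨μ, ν, ε, F, hνμ, hν, hε, hanti, hF1, hF0, hFeq⟩ :=
    exists_approximate_eigenfunctions hC hr hq hm hpos hmono
  have hFtop : ∀ n t, F n t ≠ ⊤ := fun n t => ne_top_of_le_ne_top ENNReal.one_ne_top (hF1 n t)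
  set L : ℝ≥0∞ := ENNReal.ofReal (C * r) ^ (1 / q) with hL
  have hLtop : L ≠ ⊤ := ENNReal.rpow_ne_top_of_nonneg (by positivity) ENNReal.ofReal_ne_top
  have hlip : ∀ n, LipschitzOnWith (μ * L.toNNReal) (fun t => (F n t).toReal) (Icc 0 r) := by
    intro n
    refine LipschitzOnWith.of_le_add_mul _ fun s hs t ht => ?_
    have h1 : F n s ≤ F n t + μ * (L * ENNReal.ofReal (t - s)) := by
      have h2 := dirichletSolution_le_add (s := s) hC.le hq hmono (hF1 n) ht.2
      rw [one_mul] at h2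
      calc F n s ≤ ε n + ν n * (L * ENNReal.ofReal (t - s) + dirichletSolution h q r (F n) t) := by
            rw [hFeq n s]; gcongr
        _ = F n t + ν n * (L * ENNReal.ofReal (t - s)) := by rw [hFeq n t]; ring
        _ ≤ _ := by
            gcongr
            exact hνμ n
    have h3 := ENNReal.toReal_mono (by finiteness [hFtop n t]) h1
    rw [ENNReal.toReal_add (hFtop n t) (by finiteness), ENNReal.toReal_mul, ENNReal.toReal_mul,
      ENNReal.toReal_ofReal'] at h3
    refine h3.trans ?_
    simp only [ENNReal.coe_toReal, NNReal.coe_mul, ENNReal.coe_toNNReal_eq_toReal, mul_assoc]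
    gcongr
    rw [Real.dist_eq, abs_sub_comm]
    exact max_le (le_abs_self _) (abs_nonneg _)
  obtain ⟨g, k, hk, hg⟩ := exists_subseq_tendsto_of_lipschitz hlip fun n t _ =>
    ⟨ENNReal.toReal_nonneg, by
      simpa using ENNReal.toReal_mono ENNReal.one_ne_top (hF1 n t)⟩
  have hFg : ∀ t ∈ Icc 0 r, Tendsto (fun n => F (k n) t) atTop (𝓝 (ENNReal.ofReal (g t))) :=
    fun t ht => by
      simpa [ENNReal.ofReal_toReal, hFtop] using ENNReal.tendsto_ofReal (hg t ht)
  set f₀ : ℝ → ℝ≥0∞ := fun t => ENNReal.ofReal (g t) with hf₀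
  have hfix : ∀ t ∈ Icc 0 r, f₀ t = μ * dirichletSolution h q r f₀ t := by
    intro t ht
    refine tendsto_nhds_unique (hFg t ht) ?_
    have hfin : dirichletSolution h q r f₀ t ≠ ⊤ := by
      have hb : ∀ n, dirichletSolution h q r (F (k n)) t ≤ 1 * (L * ENNReal.ofReal r) := fun n =>
        dirichletSolution_le hC.le hq hmono (hF1 (k n)) t
      refine ne_top_of_le_ne_top (b := 1 * (L * ENNReal.ofReal r)) (by finiteness)
        (le_of_tendsto' (tendsto_dirichletSolution hC.le hq hm hpos hmono
          (fun n => (hanti (k n)).measurable) (fun n => hF1 (k n))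
          (fun u hu => hFg u (Ioo_subset_Icc_self hu)) ht.1) hb)
    have hlim := tendsto_dirichletSolution hC.le hq hm hpos hmono
      (fun n => (hanti (k n)).measurable) (fun n => hF1 (k n))
      (fun u hu => hFg u (Ioo_subset_Icc_self hu)) ht.1
    simp_rw [hFeq]
    have := (hε.comp hk.tendsto_atTop).add (ENNReal.Tendsto.mul
      (ENNReal.tendsto_coe.2 (hν.comp hk.tendsto_atTop)) (Or.inr hfin) hlim
      (Or.inr ENNReal.coe_ne_top))
    simpa using this
  have h0 : f₀ 0 = 1 := by
    refine tendsto_nhds_unique (hFg 0 ⟨le_rfl, hr.le⟩) ?_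
    simp [hF0]
  have hsol : dirichletSolution h q r (fun t => μ * dirichletSolution h q r f₀ t) =
      dirichletSolution h q r f₀ := by
    have hmass : ∀ s < r, weightedMass h q (fun t => μ * dirichletSolution h q r f₀ t) s =
        weightedMass h q f₀ s := fun s hs =>
      setLIntegral_congr_fun measurableSet_Ioo fun u hu => by
        simp only [← hfix u ⟨hu.1.le, (hu.2.trans hs).le⟩]
    funext t
    refine setLIntegral_congr_fun measurableSet_Ioo fun s hs => ?_
    simp only [dirichletSlope, hmass s hs.2]
  have h00 : μ * dirichletSolution h q r f₀ 0 = 1 := by rw [← hfix 0 ⟨le_rfl, hr.le⟩, h0]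
  refine ⟨μ, fun t => μ * dirichletSolution h q r f₀ t, h00, fun t => ?_, fun t => ?_⟩
  · exact (mul_le_mul_right (dirichletSolution_le_zero hq t) _).trans h00.le
  · rw [hsol]

/-! ### The model density -/

/-- The model density is the power `N - 1` of a smooth profile, positive and almost increasing on
`(0,r)`. -/
lemma exists_modelDensity_profile {K N r : ℝ} (hN : 1 < N) (hr : 0 < r)
    (hrD : 0 < K → r < π * Real.sqrt ((N - 1) / K)) :
    ∃ k k' : ℝ → ℝ, (modelDensity K N = fun t => k t ^ (N - 1)) ∧
      (∀ t, HasDerivAt k (k' t) t) ∧ Continuous k' ∧ (∀ t ∈ Ioo 0 r, 0 < k t) ∧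
      ∃ C > 0, ∀ u s, 0 < u → u ≤ s → s < r → k u ≤ C * k s := by
  have hN' : 0 < N - 1 := sub_pos.2 hN
  rcases lt_trichotomy K 0 with hK | hK | hK
  · set a := Real.sqrt (-K / (N - 1)) with ha
    have ha0 : 0 < a := Real.sqrt_pos.2 (div_pos (neg_pos.2 hK) hN')
    refine ⟨fun t => Real.sinh (a * t), fun t => Real.cosh (a * t) * a, ?_, fun t => ?_,
      by fun_prop, fun t ht => ?_, 1, one_pos, fun u s _ hus _ => ?_⟩
    · funext t
      simp [modelDensity, hK.not_gt, hK.ne, ha]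
    · simpa using ((hasDerivAt_id t).const_mul a).sinh
    · exact Real.sinh_pos_iff.2 (mul_pos ha0 ht.1)
    · rw [one_mul]
      exact Real.sinh_le_sinh.2 (by gcongr)
  · refine ⟨id, fun _ => 1, ?_, fun t => hasDerivAt_id t, by fun_prop, fun t ht => ht.1, 1, one_pos,
      fun u s _ hus _ => by simpa using hus⟩
    funext t
    simp [modelDensity, hK]
  · set a := Real.sqrt (K / (N - 1)) with ha
    have ha0 : 0 < a := Real.sqrt_pos.2 (div_pos hK hN')
    have har : a * r < π := by
      have h1 : a * Real.sqrt ((N - 1) / K) = 1 := by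
        rw [ha, ← Real.sqrt_mul (div_pos hK hN').le]
        have : K / (N - 1) * ((N - 1) / K) = 1 := by field_simp
        rw [this, Real.sqrt_one]
      calc a * r < a * (π * Real.sqrt ((N - 1) / K)) := by gcongr; exact hrD hK
        _ = π * (a * Real.sqrt ((N - 1) / K)) := by ring
        _ = π := by rw [h1, mul_one]
    have hpos : ∀ t ∈ Ioo 0 r, 0 < Real.sin (a * t) := fun t ht =>
      Real.sin_pos_of_pos_of_lt_pi (mul_pos ha0 ht.1) ((by gcongr; exact ht.2 : a * t < a * r).trans har)
    have hposr : 0 < Real.sin (a * r) := Real.sin_pos_of_pos_of_lt_pi (by positivity) har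
    refine ⟨fun t => Real.sin (a * t), fun t => Real.cos (a * t) * a, ?_, fun t => ?_,
      by fun_prop, hpos, max 1 (1 / Real.sin (a * r)), lt_max_of_lt_left one_pos,
      fun u s hu hus hsr => ?_⟩
    · funext t
      simp [modelDensity, hK, ha]
    · simpa using ((hasDerivAt_id t).const_mul a).sin
    · have hs := hpos s ⟨hu.trans_le hus, hsr⟩
      have hle : a * u ≤ a * s := by gcongr
      have hle' : a * s ≤ a * r := by gcongr
      have hau : 0 < a * u := mul_pos ha0 hu
      rcases le_or_gt (a * s) (π / 2) with h2 | h2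
      · calc Real.sin (a * u) ≤ Real.sin (a * s) :=
              Real.sin_le_sin_of_le_of_le_pi_div_two (by linarith [Real.pi_pos]) h2 hle
          _ ≤ _ := le_mul_of_one_le_left hs.le (le_max_left _ _)
      · have h3 : Real.sin (a * r) ≤ Real.sin (a * s) := by
          rw [← Real.sin_pi_sub, ← Real.sin_pi_sub (a * s)]
          exact Real.sin_le_sin_of_le_of_le_pi_div_two (by linarith) (by linarith) (by linarith)
        calc Real.sin (a * u) ≤ 1 := Real.sin_le_one _
          _ ≤ 1 / Real.sin (a * r) * Real.sin (a * s) := by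
            rw [one_div_mul_eq_div, one_le_div hposr]
            exact h3
          _ ≤ _ := by gcongr; exact le_max_right _ _

/-- The properties of the model density on which the existence of an eigenfunction relies. -/
lemma modelDensity_properties {K N r : ℝ} (hN : 1 < N) (hr : 0 < r)
    (hrD : 0 < K → r < π * Real.sqrt ((N - 1) / K)) :
    Continuous (modelDensity K N) ∧ (∀ t ∈ Ioo 0 r, 0 < modelDensity K N t) ∧
      (∀ t ∈ Ioo 0 r, DifferentiableAt ℝ (modelDensity K N) t) ∧
      ContinuousOn (deriv (modelDensity K N)) (Ioo 0 r) ∧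
      ∃ C > 0, ∀ u s, 0 < u → u ≤ s → s < r → modelDensity K N u ≤ C * modelDensity K N s := by
  have hN' : 0 < N - 1 := sub_pos.2 hN
  obtain ⟨k, k', heq, hder, hk', hpos, C, hC, hmono⟩ := exists_modelDensity_profile hN hr hrD
  have hk : Continuous k := continuous_iff_continuousAt.2 fun t => (hder t).continuousAt
  have hd : ∀ t ∈ Ioo 0 r, HasDerivAt (modelDensity K N)
      (k' t * (N - 1) * k t ^ (N - 1 - 1)) t := fun t ht => by
    rw [heq]
    exact (hder t).rpow_const (Or.inl (hpos t ht).ne')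
  refine ⟨?_, fun t ht => ?_, fun t ht => (hd t ht).differentiableAt, ?_, C ^ (N - 1),
    by positivity, fun u s hu hus hs => ?_⟩
  · rw [heq]
    exact hk.rpow_const fun _ => Or.inr hN'.le
  · rw [heq]
    exact Real.rpow_pos_of_pos (hpos t ht) _
  · refine ContinuousOn.congr ?_ fun t ht => (hd t ht).deriv
    exact (by fun_prop : ContinuousOn (fun t => k' t * (N - 1)) (Ioo 0 r)).mul
      (hk.continuousOn.rpow_const fun t ht => Or.inl (hpos t ht).ne')
  · have hs0 : 0 < s := hu.trans_le hus
    rw [heq]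
    dsimp only
    rw [← Real.mul_rpow hC.le (hpos s ⟨hs0, hs⟩).le]
    exact Real.rpow_le_rpow (hpos u ⟨hu, hus.trans_lt hs⟩).le (hmono u s hu hus hs) hN'.le

/-! ### The weighted Hardy inequality given by an eigenfunction -/

lemma setLIntegral_Ioo_mul_lintegral_swap {r : ℝ} {a f : ℝ → ℝ≥0∞}
    (ha : AEMeasurable a (volume.restrict (Ioo 0 r)))
    (hf : AEMeasurable f (volume.restrict (Ioo 0 r))) :
    ∫⁻ t in Ioo 0 r, a t * ∫⁻ s in Ioo t r, f s = ∫⁻ s in Ioo 0 r, f s * ∫⁻ t in Ioo 0 s, a t := by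
  have hm : AEMeasurable (Function.uncurry fun t s => {p : ℝ × ℝ | p.1 < p.2}.indicator
      (fun p => a p.1 * f p.2) (t, s))
      ((volume.restrict (Ioo 0 r)).prod (volume.restrict (Ioo 0 r))) :=
    (ha.comp_fst.mul hf.comp_snd).indicator (measurableSet_lt measurable_fst measurable_snd)
  calc ∫⁻ t in Ioo 0 r, a t * ∫⁻ s in Ioo t r, f s
      = ∫⁻ t in Ioo 0 r, ∫⁻ s in Ioo 0 r, {p : ℝ × ℝ | p.1 < p.2}.indicator
          (fun p => a p.1 * f p.2) (t, s) := by
        refine setLIntegral_congr_fun measurableSet_Ioo fun t ht => ?_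
        rw [← lintegral_const_mul'' _ (hf.mono_set (Ioo_subset_Ioo_left ht.1.le)),
          ← lintegral_indicator measurableSet_Ioo, ← lintegral_indicator measurableSet_Ioo]
        refine lintegral_congr fun s => ?_
        have := ht.1
        by_cases h1 : t < s <;> by_cases h2 : s < r <;> simp [indicator, h1, h2]
        intro h3
        linarith
    _ = ∫⁻ s in Ioo 0 r, ∫⁻ t in Ioo 0 r, {p : ℝ × ℝ | p.1 < p.2}.indicator
          (fun p => a p.1 * f p.2) (t, s) := lintegral_lintegral_swap hm
    _ = _ := by
        refine setLIntegral_congr_fun measurableSet_Ioo fun s hs => ?_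
        rw [← lintegral_const_mul'' _ (ha.mono_set (Ioo_subset_Ioo_right hs.2.le)),
          ← lintegral_indicator measurableSet_Ioo, ← lintegral_indicator measurableSet_Ioo]
        refine lintegral_congr fun t => ?_
        have := hs.2
        by_cases h1 : t < s <;> by_cases h2 : 0 < t <;> simp [indicator, h1, h2, mul_comm]
        intro h3
        linarith

lemma lintegral_rpow_le_weighted {α : Type*} [MeasurableSpace α] {ν : Measure α} {p : ℝ}
    (hp : 1 < p) {B g : α → ℝ≥0∞} (hB : AEMeasurable B ν) (hg : AEMeasurable g ν)
    (hg0 : ∀ᵐ x ∂ν, g x ≠ 0) (hgtop : ∀ᵐ x ∂ν, g x ≠ ⊤) :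
    (∫⁻ x, B x ∂ν) ^ p ≤ (∫⁻ x, g x ∂ν) ^ (p - 1) * ∫⁻ x, B x ^ p / g x ^ (p - 1) ∂ν := by
  have hp0 : 0 < p := by linarith
  have hp1 : 0 < p - 1 := by linarith
  set θ := (p - 1) / p with hθ
  have hθ0 : 0 < θ := by positivity
  have hconj : p.HolderConjugate (p / (p - 1)) := Real.HolderConjugate.conjExponent hp
  have h1 : ∫⁻ x, B x ∂ν = ∫⁻ x, ((B / fun x => g x ^ θ) * fun x => g x ^ θ) x ∂ν := by
    refine lintegral_congr_ae ?_
    filter_upwards [hg0, hgtop] with x h0 ht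
    exact (ENNReal.div_mul_cancel (ENNReal.rpow_pos (pos_iff_ne_zero.2 h0) ht).ne'
      (ENNReal.rpow_ne_top_of_nonneg hθ0.le ht)).symm
  have h2 := ENNReal.lintegral_mul_le_Lp_mul_Lq ν hconj (hB.div (hg.pow_const θ)) (hg.pow_const θ)
  rw [← h1] at h2
  have h3 : ∀ x, (B x / g x ^ θ) ^ p = B x ^ p / g x ^ (p - 1) := fun x => by
    rw [ENNReal.div_rpow_of_nonneg _ _ hp0.le, ← ENNReal.rpow_mul, hθ, div_mul_cancel₀ _ hp0.ne']
  have h4 : ∀ x, (g x ^ θ) ^ (p / (p - 1)) = g x := fun x => by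
    rw [← ENNReal.rpow_mul, hθ, show (p - 1) / p * (p / (p - 1)) = 1 by field_simp,
      ENNReal.rpow_one]
  simp only [Pi.div_apply, h3, h4] at h2
  calc (∫⁻ x, B x ∂ν) ^ p ≤ _ := ENNReal.rpow_le_rpow h2 hp0.le
    _ = _ := by
      rw [ENNReal.mul_rpow_of_nonneg _ _ hp0.le, ← ENNReal.rpow_mul, ← ENNReal.rpow_mul,
        one_div_mul_cancel hp0.ne', ENNReal.rpow_one,
        show 1 / (p / (p - 1)) * p = p - 1 by field_simp, mul_comm]

section Hardy

variable {h : ℝ → ℝ} {p r : ℝ} {μ : ℝ≥0} {f : ℝ → ℝ≥0∞}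

lemma rpow_mul_dirichletSlope {q : ℝ} (hq : 0 < q) (s : ℝ) :
    (μ * dirichletSlope h q f s) ^ q =
      μ ^ q * (weightedMass h q f s / ENNReal.ofReal (h s)) := by
  rw [dirichletSlope, ENNReal.mul_rpow_of_nonneg _ _ hq.le, ← ENNReal.rpow_mul,
    one_div_mul_cancel hq.ne', ENNReal.rpow_one]

lemma rpow_mul_weightedMass {q : ℝ} (hq : 0 < q) {s : ℝ} (hs : 0 < h s) :
    μ ^ q * weightedMass h q f s = (μ * dirichletSlope h q f s) ^ q * ENNReal.ofReal (h s) := by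
  rw [rpow_mul_dirichletSlope hq, mul_assoc,
    ENNReal.div_mul_cancel (by simpa using hs) ENNReal.ofReal_ne_top]

lemma mul_dirichletSolution_eq (q t : ℝ) : μ * dirichletSolution h q r f t =
    ∫⁻ s in Ioo t r, μ * dirichletSlope h q f s :=
  (lintegral_const_mul' _ _ ENNReal.coe_ne_top).symm

/-- The weighted Hardy inequality with the optimal constant. -/
lemma hardy_of_eigenfunction (hp : 1 < p) (hm : Measurable h) (hpos : ∀ t ∈ Ioo 0 r, 0 < h t)
    (hf : Measurable f) (hfix : ∀ t, f t = μ * dirichletSolution h (p - 1) r f t)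
    (hg0 : ∀ s ∈ Ioo 0 r, (μ : ℝ≥0∞) * dirichletSlope h (p - 1) f s ≠ 0)
    (hgtop : ∀ s ∈ Ioo 0 r, (μ : ℝ≥0∞) * dirichletSlope h (p - 1) f s ≠ ⊤) {A B : ℝ → ℝ≥0∞}
    (hB : AEMeasurable B (volume.restrict (Ioo 0 r)))
    (hAB : ∀ t ∈ Ioo 0 r, A t ≤ ∫⁻ s in Ioo t r, B s) :
    (μ : ℝ≥0∞) ^ (p - 1) * ∫⁻ t in Ioo 0 r, A t ^ p * ENNReal.ofReal (h t) ≤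
      ∫⁻ t in Ioo 0 r, B t ^ p * ENNReal.ofReal (h t) := by
  have hq : 0 < p - 1 := sub_pos.2 hp
  have hμq : (μ : ℝ≥0∞) ^ (p - 1) ≠ ⊤ := ENNReal.rpow_ne_top_of_nonneg hq.le ENNReal.coe_ne_top
  set g : ℝ → ℝ≥0∞ := fun s => μ * dirichletSlope h (p - 1) f s with hg
  have hgm : Measurable g := (measurable_dirichletSlope hm).const_mul _
  have hA : ∀ t ∈ Ioo 0 r, A t ^ p ≤
      f t ^ (p - 1) * ∫⁻ s in Ioo t r, B s ^ p / g s ^ (p - 1) := by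
    intro t ht
    have hsub : Ioo t r ⊆ Ioo 0 r := Ioo_subset_Ioo_left ht.1.le
    have hae : ∀ {P : ℝ → Prop}, (∀ s ∈ Ioo 0 r, P s) → ∀ᵐ s ∂volume.restrict (Ioo t r), P s :=
      fun hP => (ae_restrict_iff' measurableSet_Ioo).2 (Eventually.of_forall fun s hs =>
        hP s (hsub hs))
    rw [hfix t, mul_dirichletSolution_eq]
    exact (ENNReal.rpow_le_rpow (hAB t ht) (by linarith)).trans
      (lintegral_rpow_le_weighted hp (hB.mono_set hsub) hgm.aemeasurable (hae hg0) (hae hgtop))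
  calc (μ : ℝ≥0∞) ^ (p - 1) * ∫⁻ t in Ioo 0 r, A t ^ p * ENNReal.ofReal (h t)
      ≤ (μ : ℝ≥0∞) ^ (p - 1) * ∫⁻ t in Ioo 0 r, (ENNReal.ofReal (h t) * f t ^ (p - 1)) *
          ∫⁻ s in Ioo t r, B s ^ p / g s ^ (p - 1) := by
        refine mul_le_mul_right (setLIntegral_mono' measurableSet_Ioo fun t ht => ?_) _
        rw [mul_comm, mul_assoc]
        exact mul_le_mul_right (hA t ht) _
    _ = (μ : ℝ≥0∞) ^ (p - 1) * ∫⁻ s in Ioo 0 r, B s ^ p / g s ^ (p - 1) *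
          weightedMass h (p - 1) f s := by
        exact congrArg (_ * ·) (setLIntegral_Ioo_mul_lintegral_swap
          (hm.ennreal_ofReal.mul (hf.pow_const _)).aemeasurable
          ((hB.pow_const p).div (hgm.pow_const _).aemeasurable))
    _ = ∫⁻ s in Ioo 0 r, B s ^ p * ENNReal.ofReal (h s) := by
        rw [← lintegral_const_mul' _ _ hμq]
        refine setLIntegral_congr_fun measurableSet_Ioo fun s hs => ?_
        rw [mul_left_comm, rpow_mul_weightedMass hq (hpos s hs), ← mul_assoc,
          ENNReal.div_mul_cancel]
        · exact (ENNReal.rpow_pos (pos_iff_ne_zero.2 (hg0 s hs)) (hgtop s hs)).ne'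
        · exact ENNReal.rpow_ne_top_of_nonneg hq.le (hgtop s hs)

lemma energy_of_eigenfunction (hp : 1 < p) (hm : Measurable h) (hpos : ∀ t ∈ Ioo 0 r, 0 < h t)
    (hf : Measurable f) (hfix : ∀ t, f t = μ * dirichletSolution h (p - 1) r f t) :
    ∫⁻ t in Ioo 0 r, (μ * dirichletSlope h (p - 1) f t) ^ p * ENNReal.ofReal (h t) =
      (μ : ℝ≥0∞) ^ (p - 1) * ∫⁻ t in Ioo 0 r, f t ^ p * ENNReal.ofReal (h t) := by
  have hq : 0 < p - 1 := sub_pos.2 hp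
  have hμq : (μ : ℝ≥0∞) ^ (p - 1) ≠ ⊤ := ENNReal.rpow_ne_top_of_nonneg hq.le ENNReal.coe_ne_top
  have hpow : ∀ x : ℝ≥0∞, x ^ p = x ^ (p - 1) * x := fun x => by
    conv_rhs => rw [← ENNReal.rpow_one x, ← ENNReal.rpow_mul, one_mul]
    rw [← ENNReal.rpow_add_of_nonneg _ _ hq.le zero_le_one, sub_add_cancel]
  have hgm : Measurable fun s => (μ : ℝ≥0∞) * dirichletSlope h (p - 1) f s :=
    (measurable_dirichletSlope hm).const_mul _
  symm
  calc (μ : ℝ≥0∞) ^ (p - 1) * ∫⁻ t in Ioo 0 r, f t ^ p * ENNReal.ofReal (h t)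
      = (μ : ℝ≥0∞) ^ (p - 1) * ∫⁻ t in Ioo 0 r, (ENNReal.ofReal (h t) * f t ^ (p - 1)) *
          ∫⁻ s in Ioo t r, μ * dirichletSlope h (p - 1) f s := by
        congr 1
        refine lintegral_congr fun t => ?_
        rw [← mul_dirichletSolution_eq, ← hfix, hpow]
        ring
    _ = (μ : ℝ≥0∞) ^ (p - 1) * ∫⁻ s in Ioo 0 r, μ * dirichletSlope h (p - 1) f s *
          weightedMass h (p - 1) f s := by
        exact congrArg (_ * ·) (setLIntegral_Ioo_mul_lintegral_swap
          (hm.ennreal_ofReal.mul (hf.pow_const _)).aemeasurable hgm.aemeasurable)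
    _ = _ := by
        rw [← lintegral_const_mul' _ _ hμq]
        refine setLIntegral_congr_fun measurableSet_Ioo fun s hs => ?_
        rw [mul_left_comm, rpow_mul_weightedMass hq (hpos s hs), hpow]
        ring

end Hardy

/-! ### Admissible competitors -/

lemma ofReal_abs_rpow_mul {p x y : ℝ} (hp : 0 ≤ p) :
    ENNReal.ofReal (|x| ^ p * y) = ENNReal.ofReal |x| ^ p * ENNReal.ofReal y := by
  rw [ENNReal.ofReal_mul (by positivity), ENNReal.ofReal_rpow_of_nonneg (abs_nonneg x) hp]

lemma IsLocAC.ofReal_abs_le {r : ℝ} {ψ dψ : ℝ → ℝ} (hψ : IsLocAC r ψ dψ)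
    (hlim : Tendsto ψ (𝓝[<] r) (𝓝 0)) {t : ℝ} (ht : t ∈ Ioo 0 r) :
    ENNReal.ofReal |ψ t| ≤ ∫⁻ s in Ioo t r, ENNReal.ofReal |dψ s| := by
  have hev : ∀ᶠ b in 𝓝[<] r, ENNReal.ofReal |ψ t| ≤
      ENNReal.ofReal |ψ b| + ∫⁻ s in Ioo t r, ENNReal.ofReal |dψ s| := by
    filter_upwards [Ioo_mem_nhdsLT ht.2] with b hb
    have h1 := hψ.2 t b ht.1 hb.1.le hb.2
    rw [intervalIntegral.integral_of_le hb.1.le] at h1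
    have h2 : |ψ t| ≤ |ψ b| + |∫ u in Ioc t b, dψ u| := by
      have : ψ t = ψ b - ∫ u in Ioc t b, dψ u := by linarith
      rw [this]
      exact abs_sub _ _
    calc ENNReal.ofReal |ψ t| ≤ ENNReal.ofReal (|ψ b| + |∫ u in Ioc t b, dψ u|) :=
          ENNReal.ofReal_le_ofReal h2
      _ = ENNReal.ofReal |ψ b| + ‖∫ u in Ioc t b, dψ u‖ₑ := by
          rw [ENNReal.ofReal_add (abs_nonneg _) (abs_nonneg _), Real.enorm_eq_ofReal_abs]
      _ ≤ ENNReal.ofReal |ψ b| + ∫⁻ s in Ioc t b, ‖dψ s‖ₑ := by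
          gcongr
          exact enorm_integral_le_lintegral_enorm _
      _ ≤ _ := by
          simp_rw [Real.enorm_eq_ofReal_abs]
          gcongr
          exact hb.2
  have hlim' : Tendsto (fun b => ENNReal.ofReal |ψ b| + ∫⁻ s in Ioo t r, ENNReal.ofReal |dψ s|)
      (𝓝[<] r) (𝓝 (ENNReal.ofReal |(0 : ℝ)| + ∫⁻ s in Ioo t r, ENNReal.ofReal |dψ s|)) :=
    (ENNReal.tendsto_ofReal hlim.abs).add_const _
  simpa using ge_of_tendsto hlim' hev

section Eigenfunction

variable {K N p r : ℝ} {μ : ℝ≥0} {f : ℝ → ℝ≥0∞}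

/-- Every admissible competitor has Rayleigh quotient at least the eigenvalue of an
eigenfunction. -/
lemma le_rayleighQuot (hp : 1 < p) (hm : Measurable (modelDensity K N))
    (hpos : ∀ t ∈ Ioo 0 r, 0 < modelDensity K N t)
    (hf : Measurable f) (hfix : ∀ t, f t = μ * dirichletSolution (modelDensity K N) (p - 1) r f t)
    (hg0 : ∀ s ∈ Ioo 0 r, (μ : ℝ≥0∞) * dirichletSlope (modelDensity K N) (p - 1) f s ≠ 0)
    (hgtop : ∀ s ∈ Ioo 0 r, (μ : ℝ≥0∞) * dirichletSlope (modelDensity K N) (p - 1) f s ≠ ⊤)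
    {ψ dψ : ℝ → ℝ} (hψ : IsAdmissible K N p r ψ dψ) :
    (μ : ℝ≥0∞) ^ (p - 1) ≤ rayleighQuot K N p r ψ dψ := by
  obtain ⟨hAC, h0, htop, hlim⟩ := hψ
  unfold rayleighQuot
  rw [ENNReal.le_div_iff_mul_le (Or.inl h0.ne') (Or.inl htop.ne)]
  simp_rw [ofReal_abs_rpow_mul (zero_le_one.trans hp.le)]
  refine hardy_of_eigenfunction hp hm hpos hf hfix hg0 hgtop ?_ fun t ht =>
    hAC.ofReal_abs_le hlim ht
  have := hAC.1.aestronglyMeasurable.aemeasurable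
  exact (measurable_abs.comp_aemeasurable this).ennreal_ofReal

/-- A continuously differentiable function on `(0,r)` is locally absolutely continuous. -/
lemma IsLocAC.of_hasDerivAt {w dw : ℝ → ℝ} (hd : ∀ t ∈ Ioo 0 r, HasDerivAt w (dw t) t)
    (hc : ContinuousOn dw (Ioo 0 r)) : IsLocAC r w dw := by
  refine ⟨hc.locallyIntegrableOn measurableSet_Ioo, fun s t hs hst ht => ?_⟩
  have hsub : uIcc s t ⊆ Ioo 0 r := by
    rw [uIcc_of_le hst]
    exact Icc_subset_Ioo hs ht
  rw [intervalIntegral.integral_eq_sub_of_hasDerivAt (fun x hx => hd x (hsub hx))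
    (hc.mono hsub).intervalIntegrable]
  ring

end Eigenfunction

/-! ### Regularity of the eigenfunction -/

section Regularity

variable {h : ℝ → ℝ} {q r : ℝ} {μ : ℝ≥0} {f : ℝ → ℝ≥0∞}

lemma lintegral_slope_ne_top (hf1 : ∀ t, f t ≤ 1)
    (hfix : ∀ t, f t = μ * dirichletSolution h q r f t) (s : ℝ) :
    ∫⁻ u in Ioc s r, μ * dirichletSlope h q f u ≠ ⊤ := by
  rw [← setLIntegral_congr (Ioo_ae_eq_Ioc (a := s) (b := r)), ← mul_dirichletSolution_eq, ← hfix]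
  exact ne_top_of_le_ne_top ENNReal.one_ne_top (hf1 s)

lemma integrableOn_slope (hm : Measurable h) (hf1 : ∀ t, f t ≤ 1)
    (hfix : ∀ t, f t = μ * dirichletSolution h q r f t) (s : ℝ) :
    IntegrableOn (fun u => (μ * dirichletSlope h q f u).toReal) (Ioc s r) :=
  integrable_toReal_of_lintegral_ne_top ((measurable_dirichletSlope hm).const_mul _).aemeasurable
    (lintegral_slope_ne_top hf1 hfix s)

lemma toReal_eigenfunction_eq (hm : Measurable h) (hf1 : ∀ t, f t ≤ 1)
    (hfix : ∀ t, f t = μ * dirichletSolution h q r f t) {s t : ℝ} (hst : s ≤ t) (htr : t ≤ r) :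
    (f s).toReal = (f t).toReal + ∫ u in s..t, (μ * dirichletSlope h q f u).toReal := by
  have hgm : Measurable fun u => (μ : ℝ≥0∞) * dirichletSlope h q f u :=
    (measurable_dirichletSlope hm).const_mul _
  have hfin : ∫⁻ u in Ioc s t, μ * dirichletSlope h q f u ≠ ⊤ :=
    ne_top_of_le_ne_top (lintegral_slope_ne_top hf1 hfix s)
      (lintegral_mono_set (Ioc_subset_Ioc_right htr))
  have hsum : f s = f t + ∫⁻ u in Ioc s t, μ * dirichletSlope h q f u := by
    rw [hfix s, hfix t, mul_dirichletSolution_eq, mul_dirichletSolution_eq,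
      setLIntegral_congr (Ioo_ae_eq_Ioc (a := s) (b := r)),
      setLIntegral_congr (Ioo_ae_eq_Ioc (a := t) (b := r)), ← Ioc_union_Ioc_eq_Ioc hst htr,
      lintegral_union measurableSet_Ioc (Ioc_disjoint_Ioc_of_le le_rfl), add_comm]
  rw [hsum, ENNReal.toReal_add (ne_top_of_le_ne_top ENNReal.one_ne_top (hf1 t)) hfin,
    intervalIntegral.integral_of_le hst,
    integral_toReal hgm.aemeasurable (ae_lt_top hgm hfin)]

lemma continuousOn_toReal_eigenfunction (hm : Measurable h) (hr : 0 ≤ r) (hf1 : ∀ t, f t ≤ 1)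
    (hfix : ∀ t, f t = μ * dirichletSolution h q r f t) :
    ContinuousOn (fun t => (f t).toReal) (Icc 0 r) := by
  have hfinite : IntegrableOn (fun u => (μ * dirichletSlope h q f u).toReal) (uIcc 0 r) := by
    rw [uIcc_of_le hr, integrableOn_Icc_iff_integrableOn_Ioc]
    exact integrableOn_slope hm hf1 hfix 0
  have hc := intervalIntegral.continuousOn_primitive_interval hfinite
  rw [uIcc_of_le hr] at hc
  refine (continuousOn_const (c := (f 0).toReal)).sub hc |>.congr fun t ht => ?_
  exact eq_sub_of_add_eq (toReal_eigenfunction_eq hm hf1 hfix ht.1 ht.2).symm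

lemma isLocAC_toReal_eigenfunction (hm : Measurable h) (hf1 : ∀ t, f t ≤ 1)
    (hfix : ∀ t, f t = μ * dirichletSolution h q r f t) :
    IsLocAC r (fun t => (f t).toReal) fun t => -(μ * dirichletSlope h q f t).toReal := by
  refine ⟨?_, fun s t _ hst ht => ?_⟩
  · exact ((integrableOn_slope hm hf1 hfix 0).mono_set Ioo_subset_Ioc_self).neg.locallyIntegrableOn
  · have := toReal_eigenfunction_eq hm hf1 hfix hst ht.le
    rw [intervalIntegral.integral_neg]
    linarith

lemma weightedMass_ne_top {C : ℝ} (hC : 0 ≤ C) (hq : 0 < q)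
    (hmono : ∀ u s, 0 < u → u ≤ s → s < r → h u ≤ C * h s) (hf1 : ∀ t, f t ≤ 1) {s : ℝ}
    (hs : s < r) : weightedMass h q f s ≠ ⊤ := by
  refine ne_top_of_le_ne_top ?_ (weightedMass_le hC hq hmono hf1 hs)
  simp only [ENNReal.one_rpow]
  finiteness

lemma hasDerivAt_weightedMass {C : ℝ} (hC : 0 ≤ C) (hq : 0 < q) (hm : Measurable h)
    (hpos : ∀ t ∈ Ioo 0 r, 0 < h t) (hcont : ContinuousOn h (Ioo 0 r))
    (hmono : ∀ u s, 0 < u → u ≤ s → s < r → h u ≤ C * h s) (hf : Measurable f)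
    (hf1 : ∀ t, f t ≤ 1) (hfc : ContinuousOn (fun t => (f t).toReal) (Ioo 0 r)) {s : ℝ}
    (hs : s ∈ Ioo 0 r) :
    HasDerivAt (fun s => (weightedMass h q f s).toReal) (h s * (f s).toReal ^ q) s := by
  set F : ℝ → ℝ≥0∞ := fun u => ENNReal.ofReal (h u) * f u ^ q with hF
  have hFm : Measurable F := hm.ennreal_ofReal.mul (hf.pow_const q)
  have hfinite : ∀ t ∈ Ioo 0 r, ∫⁻ u in Ioc 0 t, F u ≠ ⊤ := fun t ht => by
    rw [← setLIntegral_congr (Ioo_ae_eq_Ioc (a := 0) (b := t))]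
    exact weightedMass_ne_top hC hq hmono hf1 ht.2
  have hFeq : ∀ u ∈ Ioo 0 r, (F u).toReal = h u * (f u).toReal ^ q := fun u hu => by
    rw [hF, ENNReal.toReal_mul, ENNReal.toReal_ofReal (hpos u hu).le, ENNReal.toReal_rpow]
  have hmass : ∀ t ∈ Ioo 0 r, (weightedMass h q f t).toReal = ∫ u in (0 : ℝ)..t, (F u).toReal := by
    intro t ht
    rw [intervalIntegral.integral_of_le ht.1.le,
      integral_toReal hFm.aemeasurable (ae_lt_top hFm (hfinite t ht)),
      ← setLIntegral_congr (Ioo_ae_eq_Ioc (a := 0) (b := t))]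
    rfl
  have hii : IntervalIntegrable (fun u => (F u).toReal) volume 0 s := by
    rw [intervalIntegrable_iff_integrableOn_Ioc_of_le hs.1.le]
    exact integrable_toReal_of_lintegral_ne_top hFm.aemeasurable (hfinite s hs)
  have hFc : ContinuousOn (fun u => (F u).toReal) (Ioo 0 r) :=
    (hcont.mul (hfc.rpow_const fun _ _ => Or.inr hq.le)).congr hFeq
  have hder := intervalIntegral.integral_hasDerivAt_right hii
    (hFm.ennreal_toReal.stronglyMeasurable.stronglyMeasurableAtFilter)
    (hFc.continuousAt (isOpen_Ioo.mem_nhds hs))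
  rw [hFeq s hs] at hder
  exact hder.congr_of_eventuallyEq (Filter.eventuallyEq_of_mem (isOpen_Ioo.mem_nhds hs) hmass)

end Regularity

/-- existence and Euler–Lagrange equation for the first Dirichlet
`p`-eigenfunction of the `(K,N)`-model interval. There is a nonnegative admissible
minimizer `φ` of `λ_p(K,N,r)`, and `|φ'|^{p−2} φ'` admits a locally absolutely continuous
representative `w` solving `w' + w · h_{K,N}'/h_{K,N} = −λ_p(K,N,r) |φ|^{p−2} φ` a.e. -/
theorem exists_model_eigenfunction
    (K N p r : ℝ) (hN : 1 < N) (hp : 1 < p)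
    (hr : 0 < r) (hrD : 0 < K → r < π * Real.sqrt ((N - 1) / K)) :
    ∃ φ dφ : ℝ → ℝ,
      IsAdmissible K N p r φ dφ ∧
      (∀ t ∈ Set.Ioo 0 r, 0 ≤ φ t) ∧
      rayleighQuot K N p r φ dφ = lambdaP K N p r ∧
      ∃ w dw : ℝ → ℝ,
        IsLocAC r w dw ∧
        (∀ᵐ t : ℝ ∂volume, t ∈ Set.Ioo 0 r → w t = |dφ t| ^ (p - 2) * dφ t) ∧
        ∀ᵐ t : ℝ ∂volume, t ∈ Set.Ioo 0 r →
          dw t + w t * (deriv (modelDensity K N) t / modelDensity K N t) =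
            -(lambdaP K N p r).toReal * |φ t| ^ (p - 2) * φ t := by
  obtain ⟨hcont, hpos, hdiff, hderc, C, hC, hmono⟩ := modelDensity_properties hN hr hrD
  set h := modelDensity K N with hh
  have hm : Measurable h := hcont.measurable
  have hq : 0 < p - 1 := sub_pos.2 hp
  have hp0 : 0 ≤ p := by linarith
  obtain ⟨μ, f, hf0, hf1, hfix⟩ := exists_dirichletSolution_eigenfunction hC hr hq hm hpos hmono
  have hftop : ∀ t, f t ≠ ⊤ := fun t => ne_top_of_le_ne_top ENNReal.one_ne_top (hf1 t)
  have hμ : (μ : ℝ≥0∞) ≠ 0 := by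
    rintro hμ
    have := hfix 0
    simp [hf0, hμ] at this
  have hf : Measurable f := by
    have : Antitone f := fun s t hst => by
      rw [hfix s, hfix t]
      exact mul_le_mul_right (antitone_dirichletSolution hst) _
    exact this.measurable
  set φ : ℝ → ℝ := fun t => (f t).toReal with hφ
  set g : ℝ → ℝ≥0∞ := fun t => μ * dirichletSlope h (p - 1) f t with hg
  have hφc : ContinuousOn φ (Icc 0 r) := continuousOn_toReal_eigenfunction hm hr.le hf1 hfix
  have hφc' : ContinuousOn φ (Ioo 0 r) := hφc.mono Ioo_subset_Icc_self
  obtain ⟨δ, hδ, hfδ⟩ : ∃ δ > 0, ∀ u ∈ Ioo 0 δ, f u ≠ 0 := by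
    have h1 : ∀ᶠ u in 𝓝[Icc 0 r] 0, 0 < φ u :=
      (hφc 0 ⟨le_rfl, hr.le⟩).eventually (lt_mem_nhds (by simp [hφ, hf0]))
    have h2 : ∀ᶠ u in 𝓝[>] (0 : ℝ), 0 < φ u :=
      nhdsWithin_le_of_mem (Icc_mem_nhdsGT hr) h1
    obtain ⟨δ, hδ, hsub⟩ := mem_nhdsGT_iff_exists_Ioo_subset.1 h2
    exact ⟨δ, hδ, fun u hu hu0 => by simpa [hφ, hu0] using hsub hu⟩
  have hφpos : ∀ t ∈ Ioo 0 r, 0 < φ t := fun t ht => by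
    refine ENNReal.toReal_pos ?_ (hftop t)
    rw [hfix t]
    exact mul_ne_zero hμ (dirichletSolution_pos hm hpos hq hf hδ hfδ ht.1.le ht.2).ne'
  have hg0 : ∀ s ∈ Ioo 0 r, g s ≠ 0 := fun s hs =>
    mul_ne_zero hμ (dirichletSlope_pos hm hpos hq hf hδ hfδ hs).ne'
  have hgtop : ∀ s ∈ Ioo 0 r, g s ≠ ⊤ := fun s hs => by
    refine ENNReal.mul_ne_top ENNReal.coe_ne_top (ne_top_of_le_ne_top ?_
      (dirichletSlope_le hC.le hq hmono hf1 hs.2))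
    rw [one_mul]
    exact ENNReal.rpow_ne_top_of_nonneg (by positivity) ENNReal.ofReal_ne_top
  have hgpos : ∀ s ∈ Ioo 0 r, 0 < (g s).toReal := fun s hs =>
    ENNReal.toReal_pos (hg0 s hs) (hgtop s hs)
  have hnorm : ∫⁻ t in Ioo 0 r, ENNReal.ofReal (|φ t| ^ p * h t) =
      ∫⁻ t in Ioo 0 r, f t ^ p * ENNReal.ofReal (h t) := by
    refine lintegral_congr fun t => ?_
    rw [ofReal_abs_rpow_mul hp0, abs_of_nonneg ENNReal.toReal_nonneg,
      ENNReal.ofReal_toReal (hftop t)]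
  have henergy : ∫⁻ t in Ioo 0 r, ENNReal.ofReal (|-(g t).toReal| ^ p * h t) =
      (μ : ℝ≥0∞) ^ (p - 1) * ∫⁻ t in Ioo 0 r, f t ^ p * ENNReal.ofReal (h t) := by
    rw [← energy_of_eigenfunction hp hm hpos hf hfix]
    refine setLIntegral_congr_fun measurableSet_Ioo fun t ht => ?_
    rw [ofReal_abs_rpow_mul hp0, abs_neg, abs_of_nonneg ENNReal.toReal_nonneg,
      ENNReal.ofReal_toReal (hgtop t ht)]
  have hnorm0 : 0 < ∫⁻ t in Ioo 0 r, f t ^ p * ENNReal.ofReal (h t) := by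
    have hmeas : Measurable fun t => f t ^ p * ENNReal.ofReal (h t) :=
      (hf.pow_const p).mul hm.ennreal_ofReal
    rw [setLIntegral_pos_iff hmeas]
    have hsub : Ioo 0 r ⊆ Function.support (fun t => f t ^ p * ENNReal.ofReal (h t)) ∩ Ioo 0 r :=
      fun t ht => ⟨mul_ne_zero
        (ENNReal.rpow_pos (ENNReal.toReal_pos_iff.1 (hφpos t ht)).1 (hftop t)).ne'
        (by simpa using hpos t ht), ht⟩
    refine lt_of_lt_of_le ?_ (measure_mono hsub)
    simpa using hr
  have hnormtop : ∫⁻ t in Ioo 0 r, f t ^ p * ENNReal.ofReal (h t) < ⊤ := by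
    obtain ⟨M, hM⟩ := isCompact_Icc.exists_bound_of_continuousOn (hcont.continuousOn (s := Icc 0 r))
    refine (setLIntegral_mono (g := fun _ => ENNReal.ofReal M) measurable_const
      fun t ht => ?_).trans_lt ?_
    · calc f t ^ p * ENNReal.ofReal (h t) ≤ 1 ^ p * ENNReal.ofReal M := by
            gcongr
            exacts [hf1 t, (le_abs_self _).trans (hM t (Ioo_subset_Icc_self ht))]
        _ = ENNReal.ofReal M := by simp
    · rw [setLIntegral_const, Real.volume_Ioo]
      finiteness
  have hadm : IsAdmissible K N p r φ fun t => -(g t).toReal := by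
    refine ⟨isLocAC_toReal_eigenfunction hm hf1 hfix, ?_, ?_, ?_⟩
    · rw [← hh, hnorm]
      exact hnorm0
    · rw [← hh, hnorm]
      exact hnormtop
    · have h1 := hφc r ⟨hr.le, le_rfl⟩
      have h2 : φ r = 0 := by
        simp only [hφ]
        rw [hfix, dirichletSolution_apply_right]
        simp
      rw [← h2]
      exact h1.mono_left (nhdsWithin_le_of_mem (Icc_mem_nhdsLT hr))
  have hray : rayleighQuot K N p r φ (fun t => -(g t).toReal) = (μ : ℝ≥0∞) ^ (p - 1) := by
    unfold rayleighQuot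
    rw [← hh, hnorm, henergy, ENNReal.mul_div_cancel_right hnorm0.ne' hnormtop.ne]
  have hlam : lambdaP K N p r = (μ : ℝ≥0∞) ^ (p - 1) := by
    refine le_antisymm ?_ ?_
    · rw [← hray]
      exact iInf₂_le_of_le _ _ (iInf_le _ hadm)
    · exact le_iInf₂ fun ψ dψ => le_iInf fun hψ =>
        le_rayleighQuot hp hm hpos hf hfix hg0 hgtop hψ
  set lam : ℝ := (lambdaP K N p r).toReal with hlamdef
  set I : ℝ → ℝ := fun s => (weightedMass h (p - 1) f s).toReal with hI
  have hId : ∀ s ∈ Ioo 0 r, HasDerivAt I (h s * φ s ^ (p - 1)) s := fun s hs =>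
    hasDerivAt_weightedMass hC.le hq hm hpos hcont.continuousOn hmono hf hf1 hφc' hs
  have hIc : ContinuousOn I (Ioo 0 r) := fun s hs => (hId s hs).continuousAt.continuousWithinAt
  have hgI : ∀ s ∈ Ioo 0 r, (g s).toReal ^ (p - 1) = lam * I s / h s := fun s hs => by
    rw [ENNReal.toReal_rpow, hg, rpow_mul_dirichletSlope hq, hlamdef, hlam, ENNReal.toReal_mul,
      ENNReal.toReal_div, ENNReal.toReal_ofReal (hpos s hs).le, mul_div_assoc]
  refine ⟨φ, fun t => -(g t).toReal, hadm, fun t ht => (hφpos t ht).le, by rw [hray, hlam],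
    fun s => -lam * I s / h s,
    fun s => (-lam * (h s * φ s ^ (p - 1)) * h s - -lam * I s * deriv h s) / h s ^ 2, ?_, ?_, ?_⟩
  · refine IsLocAC.of_hasDerivAt (fun s hs => ?_) ?_
    · exact ((hId s hs).const_mul (-lam)).div (hdiff s hs).hasDerivAt (hpos s hs).ne'
    · have h1 : ContinuousOn (fun s => φ s ^ (p - 1)) (Ioo 0 r) :=
        hφc'.rpow_const fun _ _ => Or.inr hq.le
      exact ((((continuousOn_const.mul (hcont.continuousOn.mul h1)).mul hcont.continuousOn)).sub
        ((continuousOn_const.mul hIc).mul hderc)).div (hcont.continuousOn.pow 2)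
        fun s hs => (pow_pos (hpos s hs) 2).ne'
  · refine Eventually.of_forall fun s hs => ?_
    have h1 := hgpos s hs
    rw [abs_neg, abs_of_pos h1, mul_neg, ← Real.rpow_add_one h1.ne',
      show p - 2 + 1 = p - 1 by ring, hgI s hs]
    ring
  · refine Eventually.of_forall fun s hs => ?_
    have h1 := hφpos s hs
    have h2 := (hpos s hs).ne'
    rw [abs_of_pos h1, mul_assoc, ← Real.rpow_add_one h1.ne', show p - 2 + 1 = p - 1 by ring]
    field_simp
    ring
end

section
/- Let K ∈ ℝ, N ∈ (1,∞), p ∈ (1,∞) and r ∈ (0, D_{K,N}). Let φ : (0,r) → [0,∞) be a nonnegative locally absolutely continuous minimizer of λ_p(K,N,r) (i.e. φ is admissible in the definition of λ_p(K,N,r) and attains the infimum), and let w be the locally absolutely continuous representative of |φ'|^{p−2}·φ' satisfying w'(t) + w(t)·(h_{K,N}'(t)/h_{K,N}(t)) = −λ_p(K,N,r)·|φ(t)|^{p−2}·φ(t) for almost every t ∈ (0,r). Then lim_{t↓0} w(t) = 0, and φ is non-increasing on (0,r). -/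
open Real MeasureTheory Filter Set
open scoped ENNReal NNReal Topology

lemma exists_modelDensity_eq_rpow {K N r : ℝ} (hN : 1 < N)
    (hrD : 0 < K → r < π * Real.sqrt ((N - 1) / K)) :
    ∃ (f : ℝ → ℝ) (k : ℝ), 0 < k ∧ ContDiff ℝ 1 f ∧ f 0 = 0 ∧ HasDerivAt f k 0 ∧
      (∀ t ∈ Ioo 0 r, 0 < f t) ∧ modelDensity K N = fun t => f t ^ (N - 1) := by
  have hN' : 0 < N - 1 := by linarith
  rcases lt_trichotomy K 0 with hK | hK | hK
  · have hk : 0 < √(-K / (N - 1)) := Real.sqrt_pos.2 (div_pos (by linarith) hN')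
    refine ⟨fun t => Real.sinh (√(-K / (N - 1)) * t), √(-K / (N - 1)), hk, ?_, by simp, ?_, ?_, ?_⟩
    · exact Real.contDiff_sinh.comp (contDiff_const.mul contDiff_id)
    · simpa using ((hasDerivAt_id (0 : ℝ)).const_mul √(-K / (N - 1))).sinh
    · exact fun t ht => Real.sinh_pos_iff.2 (mul_pos hk ht.1)
    · funext t
      simp [modelDensity, hK.not_gt, hK.ne]
  · refine ⟨fun t => t, 1, one_pos, contDiff_id, rfl, hasDerivAt_id 0, fun t ht => ht.1, ?_⟩
    funext t
    simp [modelDensity, hK]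
  · have hk : 0 < √(K / (N - 1)) := Real.sqrt_pos.2 (div_pos hK hN')
    refine ⟨fun t => Real.sin (√(K / (N - 1)) * t), √(K / (N - 1)), hk, ?_, by simp, ?_, ?_, ?_⟩
    · exact Real.contDiff_sin.comp (contDiff_const.mul contDiff_id)
    · simpa using ((hasDerivAt_id (0 : ℝ)).const_mul √(K / (N - 1))).sin
    · intro t ht
      refine Real.sin_pos_of_pos_of_lt_pi (mul_pos hk ht.1) ?_
      have h1 : √(K / (N - 1)) * √((N - 1) / K) = 1 := by
        rw [← Real.sqrt_mul (div_pos hK hN').le, div_mul_div_cancel₀ hN'.ne', div_self hK.ne',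
          Real.sqrt_one]
      calc √(K / (N - 1)) * t < √(K / (N - 1)) * (π * √((N - 1) / K)) :=
            mul_lt_mul_of_pos_left (ht.2.trans (hrD hK)) hk
        _ = π * (√(K / (N - 1)) * √((N - 1) / K)) := by ring
        _ = π := by rw [h1, mul_one]
    · funext t
      simp [modelDensity, hK]

lemma continuous_modelDensity {K N r : ℝ} (hN : 1 < N)
    (hrD : 0 < K → r < π * Real.sqrt ((N - 1) / K)) : Continuous (modelDensity K N) := by
  obtain ⟨f, k, -, hf, -, -, -, h⟩ := exists_modelDensity_eq_rpow hN hrD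
  rw [h]
  exact hf.continuous.rpow_const fun _ => Or.inr (by linarith)

lemma modelDensity_pos {K N r : ℝ} (hN : 1 < N)
    (hrD : 0 < K → r < π * Real.sqrt ((N - 1) / K)) {t : ℝ} (ht : t ∈ Ioo 0 r) :
    0 < modelDensity K N t := by
  obtain ⟨f, k, -, -, -, -, hf, h⟩ := exists_modelDensity_eq_rpow hN hrD
  rw [h]
  exact Real.rpow_pos_of_pos (hf t ht) _

lemma contDiffOn_modelDensity {K N r : ℝ} (hN : 1 < N)
    (hrD : 0 < K → r < π * Real.sqrt ((N - 1) / K)) :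
    ContDiffOn ℝ 1 (modelDensity K N) (Ioo 0 r) := by
  obtain ⟨f, k, -, hf, -, -, hpos, h⟩ := exists_modelDensity_eq_rpow hN hrD
  rw [h]
  exact hf.contDiffOn.rpow_const_of_ne fun t ht => (hpos t ht).ne'

/-- Near `0` the model density is comparable to `t ^ (N - 1)`. -/
lemma exists_modelDensity_bounds {K N r : ℝ} (hN : 1 < N) (hr : 0 < r)
    (hrD : 0 < K → r < π * Real.sqrt ((N - 1) / K)) :
    ∃ s₀ ∈ Ioo 0 r, s₀ ≤ 1 ∧ ∃ c₁ c₂ : ℝ, 0 < c₁ ∧ 0 < c₂ ∧ ∀ t ∈ Ioc 0 s₀,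
      c₁ * t ^ (N - 1) ≤ modelDensity K N t ∧ modelDensity K N t ≤ c₂ * t ^ (N - 1) := by
  obtain ⟨f, k, hk, -, hf0, hfd, hpos, h⟩ := exists_modelDensity_eq_rpow hN hrD
  have hsl : Tendsto (fun t => f t / t) (𝓝[>] 0) (𝓝 k) := by
    have := hfd.tendsto_slope.mono_left (nhdsWithin_mono 0 (fun t (ht : 0 < t) => ht.ne'))
    refine this.congr fun t => ?_
    simp [slope_def_field, hf0]
  have hev := (hsl.eventually (Ioo_mem_nhds (by linarith : k / 2 < k) (by linarith : k < 2 * k)))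
  obtain ⟨u, hu, hsub⟩ := mem_nhdsGT_iff_exists_Ioo_subset.1 hev
  have hu0 : (0 : ℝ) < u := hu
  refine ⟨min (u / 2) (min (r / 2) 1), ⟨by positivity, ?_⟩, ?_, (k / 2) ^ (N - 1),
    (2 * k) ^ (N - 1), by positivity, by positivity, ?_⟩
  · exact ((min_le_right _ _).trans (min_le_left _ _)).trans_lt (by linarith)
  · exact (min_le_right _ _).trans (min_le_right _ _)
  · intro t ht
    have ht0 : 0 < t := ht.1
    have htu : t < u := (ht.2.trans (min_le_left _ _)).trans_lt (by linarith)
    obtain ⟨h1, h2⟩ : k / 2 < f t / t ∧ f t / t < 2 * k := hsub ⟨ht0, htu⟩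
    rw [lt_div_iff₀ ht0] at h1
    rw [div_lt_iff₀ ht0] at h2
    have hN' : 0 ≤ N - 1 := by linarith
    have hft : 0 ≤ f t := (by positivity : 0 ≤ k / 2 * t).trans h1.le
    rw [h, ← Real.mul_rpow (by positivity) ht0.le, ← Real.mul_rpow (by positivity) ht0.le]
    exact ⟨Real.rpow_le_rpow (by positivity) h1.le hN', Real.rpow_le_rpow hft h2.le hN'⟩

namespace IsLocAC

variable {r : ℝ} {φ dφ : ℝ → ℝ}

lemma intervalIntegrable (h : IsLocAC r φ dφ) {s t : ℝ} (hs : 0 < s) (hst : s ≤ t) (ht : t < r) :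
    IntervalIntegrable dφ volume s t := by
  rw [intervalIntegrable_iff_integrableOn_Icc_of_le hst]
  exact h.1.integrableOn_compact_subset (Icc_subset_Ioo hs ht) isCompact_Icc

lemma continuousOn (h : IsLocAC r φ dφ) : ContinuousOn φ (Ioo 0 r) := by
  intro x hx
  have hx2 : 0 < x / 2 := by linarith [hx.1]
  have hxr : (x + r) / 2 < r := by linarith [hx.2]
  have hle : x / 2 ≤ (x + r) / 2 := by linarith [hx.1, hx.2]
  have hc := intervalIntegral.continuousOn_primitive_interval
    (f := dφ) (μ := volume) (a := x / 2) (b := (x + r) / 2)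
    (by
      rw [uIcc_of_le hle]
      exact h.1.integrableOn_compact_subset (Icc_subset_Ioo hx2 hxr) isCompact_Icc)
  rw [uIcc_of_le hle] at hc
  have hφ : ContinuousOn φ (Icc (x / 2) ((x + r) / 2)) :=
    (continuousOn_const.add hc).congr fun t ht => h.2 _ _ hx2 ht.1 (ht.2.trans_lt hxr)
  exact (hφ.continuousAt (Icc_mem_nhds (by linarith [hx.1]) (by linarith [hx.2])))
    |>.continuousWithinAt

lemma aestronglyMeasurable (h : IsLocAC r φ dφ) :
    AEStronglyMeasurable dφ (volume.restrict (Ioo 0 r)) :=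
  h.1.aestronglyMeasurable

/-- Integration of the derivative of a product with a `C¹` weight. -/
lemma integral_deriv_mul_add (h : IsLocAC r φ dφ) {g : ℝ → ℝ} (hg : ContDiffOn ℝ 1 g (Ioo 0 r))
    {s t : ℝ} (hs : 0 < s) (hst : s ≤ t) (ht : t < r) :
    ∫ x in s..t, (deriv g x * φ x + g x * dφ x) = g t * φ t - g s * φ s := by
  set W : ℝ → ℝ := fun x => φ s + ∫ u in s..x, dφ u with hW
  have hi := h.intervalIntegrable hs hst ht
  have hWac : AbsolutelyContinuousOnInterval W s t := by
    have h1 : AbsolutelyContinuousOnInterval (fun _ : ℝ => φ s) s t :=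
      (contDiff_const.contDiffOn (n := 1)).absolutelyContinuousOnInterval
    exact h1.add (hi.absolutelyContinuousOnInterval_intervalIntegral left_mem_uIcc)
  have hgac : AbsolutelyContinuousOnInterval g s t := by
    refine (hg.mono ?_).absolutelyContinuousOnInterval
    rw [uIcc_of_le hst]
    exact Icc_subset_Ioo hs ht
  have key := hgac.integral_deriv_mul_eq_sub hWac
  rw [show W t = φ t from (h.2 s t hs hst ht).symm, show W s = φ s by simp [hW]] at key
  rw [← key]
  apply intervalIntegral.integral_congr_ae
  filter_upwards [hi.ae_hasDerivAt_integral] with x hx hxI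
  have hd : HasDerivAt W (dφ x) x :=
    (hx (uIoc_subset_uIcc hxI) s left_mem_uIcc).const_add (φ s)
  rw [uIoc_of_le hst] at hxI
  rw [hd.deriv, show W x = φ x from (h.2 s x hs hxI.1.le (hxI.2.trans_lt ht)).symm]

/-- Freezing a locally absolutely continuous function to the left of `s`. -/
lemma comp_max (h : IsLocAC r φ dφ) (s : ℝ) :
    IsLocAC r (fun t => φ (max t s)) ((Ioi s).indicator dφ) := by
  refine ⟨fun x hx => ?_, ?_⟩
  · obtain ⟨u, hu, hi⟩ := h.1 x hx
    exact ⟨u, hu, hi.indicator measurableSet_Ioi⟩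
  · intro a b ha hab hb
    rcases le_total b s with hbs | hsb
    · have h0 : ∫ u in a..b, (Ioi s).indicator dφ u = 0 := by
        rw [intervalIntegral.integral_of_le hab, setIntegral_indicator measurableSet_Ioi]
        have : Ioc a b ∩ Ioi s = ∅ := by
          ext u; simp only [mem_inter_iff, mem_Ioc, mem_Ioi, mem_empty_iff_false, iff_false]
          rintro ⟨⟨-, h1⟩, h2⟩; linarith
        simp [this]
      simp [h0, max_eq_right hbs, max_eq_right (hab.trans hbs)]
    · have hmax : max a s ≤ b := max_le hab hsb
      have h1 : ∫ u in a..b, (Ioi s).indicator dφ u = ∫ u in (max a s)..b, dφ u := by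
        rw [intervalIntegral.integral_of_le hab, setIntegral_indicator measurableSet_Ioi,
          intervalIntegral.integral_of_le hmax]
        congr 2
        ext u; simp only [mem_inter_iff, mem_Ioc, mem_Ioi, max_lt_iff]
        tauto
      simp only [max_eq_left hsb, h1]
      exact h.2 _ _ (lt_max_of_lt_left ha) hmax hb

end IsLocAC

lemma lintegral_ofReal_lt_top_of_continuous {f : ℝ → ℝ} (hf : Continuous f) (a b : ℝ) :
    ∫⁻ t in Ioo a b, ENNReal.ofReal (f t) < ⊤ :=
  ((hf.integrableOn_Icc (a := a) (b := b)).mono_set Ioo_subset_Icc_self).lintegral_lt_top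

lemma setLIntegral_ofReal_Ioo_pos {f : ℝ → ℝ} {a b : ℝ} (hab : a < b)
    (hf : ContinuousOn f (Ioo a b)) (hpos : ∀ t ∈ Ioo a b, 0 < f t) :
    0 < ∫⁻ t in Ioo a b, ENNReal.ofReal (f t) := by
  rw [pos_iff_ne_zero, Ne, lintegral_eq_zero_iff'
    (hf.aemeasurable measurableSet_Ioo).ennreal_ofReal]
  intro h0
  have h1 : ∀ᵐ t ∂volume.restrict (Ioo a b), False := by
    filter_upwards [h0, ae_restrict_mem measurableSet_Ioo] with t ht htI
    exact (ENNReal.ofReal_pos.2 (hpos t htI)).ne' ht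
  rw [ae_iff] at h1
  simp only [not_false_eq_true, ofPred_true, Measure.restrict_apply_univ, Real.volume_Ioo,
    ENNReal.ofReal_eq_zero] at h1
  linarith

lemma setIntegral_Ioo_pos {f : ℝ → ℝ} {a b : ℝ} (hab : a < b) (hf : IntegrableOn f (Ioo a b))
    (hpos : ∀ᵐ t, t ∈ Ioo a b → 0 < f t) : 0 < ∫ t in Ioo a b, f t := by
  have hpos' : ∀ᵐ t ∂volume.restrict (Ioo a b), 0 < f t :=
    (ae_restrict_iff' measurableSet_Ioo).2 hpos
  refine (integral_nonneg_of_ae (hpos'.mono fun t ht => ht.le)).lt_of_ne' fun h0 => ?_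
  rw [integral_eq_zero_iff_of_nonneg_ae (hpos'.mono fun t ht => ht.le) hf] at h0
  have h1 : ∀ᵐ t ∂volume.restrict (Ioo a b), False := by
    filter_upwards [h0, hpos'] with t ht htI
    exact htI.ne' ht
  rw [ae_iff] at h1
  simp only [not_false_eq_true, ofPred_true, Measure.restrict_apply_univ, Real.volume_Ioo,
    ENNReal.ofReal_eq_zero] at h1
  linarith

lemma lambdaP_le {K N p r : ℝ} {φ dφ : ℝ → ℝ} (h : IsAdmissible K N p r φ dφ) :
    lambdaP K N p r ≤ rayleighQuot K N p r φ dφ :=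
  iInf_le_of_le φ (iInf_le_of_le dφ (iInf_le _ h))

lemma lambdaP_lt_top {K N p r : ℝ} (hN : 1 < N) (hp : 1 < p) (hr : 0 < r)
    (hrD : 0 < K → r < π * Real.sqrt ((N - 1) / K)) : lambdaP K N p r < ⊤ := by
  have hc := continuous_modelDensity hN hrD
  have hp0 : 0 ≤ p := by linarith
  have hc1 : Continuous fun t : ℝ => |r - t| ^ p * modelDensity K N t :=
    ((continuous_const.sub continuous_id).abs.rpow_const fun _ => Or.inr hp0).mul hc
  have hM : 0 < ∫⁻ t in Ioo 0 r, ENNReal.ofReal (|r - t| ^ p * modelDensity K N t) := by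
    refine setLIntegral_ofReal_Ioo_pos hr hc1.continuousOn fun t ht => ?_
    have : 0 < |r - t| := abs_pos.2 (by linarith [ht.2])
    have := modelDensity_pos hN hrD ht
    positivity
  have hadm : IsAdmissible K N p r (fun t => r - t) (fun _ => -1) := by
    refine ⟨⟨(continuous_const.locallyIntegrable).locallyIntegrableOn _, ?_⟩, hM,
      lintegral_ofReal_lt_top_of_continuous hc1 0 r, ?_⟩
    · intro s t _ _ _
      simp
    · have : Tendsto (fun t : ℝ => r - t) (𝓝 r) (𝓝 (r - r)) :=
        (continuous_const.sub continuous_id).tendsto r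
      rw [sub_self] at this
      exact this.mono_left nhdsWithin_le_nhds
  refine (lambdaP_le hadm).trans_lt (ENNReal.div_lt_top ?_ hM.ne')
  exact (lintegral_ofReal_lt_top_of_continuous (continuous_const.mul hc) 0 r).ne

lemma lintegral_energy_eq {K N p r : ℝ} {φ dφ : ℝ → ℝ} (hadm : IsAdmissible K N p r φ dφ)
    (hmin : rayleighQuot K N p r φ dφ = lambdaP K N p r) :
    ∫⁻ t in Ioo 0 r, ENNReal.ofReal (|dφ t| ^ p * modelDensity K N t) =
      lambdaP K N p r * ∫⁻ t in Ioo 0 r, ENNReal.ofReal (|φ t| ^ p * modelDensity K N t) := by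
  rw [← hmin, rayleighQuot, ENNReal.div_mul_cancel hadm.2.1.ne' hadm.2.2.1.ne]

lemma integrableOn_energy {K N p r : ℝ} (hN : 1 < N) (hp : 1 < p) (hr : 0 < r)
    (hrD : 0 < K → r < π * Real.sqrt ((N - 1) / K)) {φ dφ : ℝ → ℝ}
    (hadm : IsAdmissible K N p r φ dφ) (hmin : rayleighQuot K N p r φ dφ = lambdaP K N p r) :
    IntegrableOn (fun t => |dφ t| ^ p * modelDensity K N t) (Ioo 0 r) := by
  have hp0 : 0 ≤ p := by linarith
  refine (lintegral_ofReal_ne_top_iff_integrable ?_ ?_).1 ?_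
  · exact ((Real.continuous_rpow_const hp0).comp_aestronglyMeasurable
      (continuous_abs.comp_aestronglyMeasurable hadm.1.aestronglyMeasurable)).mul
      (continuous_modelDensity hN hrD).aestronglyMeasurable
  · filter_upwards [ae_restrict_mem measurableSet_Ioo] with t ht
    have := modelDensity_pos hN hrD ht
    positivity
  · rw [lintegral_energy_eq hadm hmin]
    exact ENNReal.mul_ne_top (lambdaP_lt_top hN hp hr hrD).ne hadm.2.2.1.ne

lemma continuousOn_mass {K N p r : ℝ} (hN : 1 < N) (hp : 1 < p)
    (hrD : 0 < K → r < π * Real.sqrt ((N - 1) / K)) {φ dφ : ℝ → ℝ}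
    (hφ : IsLocAC r φ dφ) :
    ContinuousOn (fun t => |φ t| ^ p * modelDensity K N t) (Ioo 0 r) :=
  (hφ.continuousOn.abs.rpow_const fun _ _ => Or.inr (by linarith)).mul
    (continuous_modelDensity hN hrD).continuousOn

lemma integrableOn_mass {K N p r : ℝ} (hN : 1 < N) (hp : 1 < p)
    (hrD : 0 < K → r < π * Real.sqrt ((N - 1) / K)) {φ dφ : ℝ → ℝ}
    (hadm : IsAdmissible K N p r φ dφ) :
    IntegrableOn (fun t => |φ t| ^ p * modelDensity K N t) (Ioo 0 r) := by
  refine (lintegral_ofReal_ne_top_iff_integrable ?_ ?_).1 hadm.2.2.1.ne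
  · exact (continuousOn_mass hN hp hrD hadm.1).aestronglyMeasurable measurableSet_Ioo
  · filter_upwards [ae_restrict_mem measurableSet_Ioo] with t ht
    have := modelDensity_pos hN hrD ht
    positivity

lemma setLIntegral_Ioo_eq_add (f : ℝ → ℝ≥0∞) {s r : ℝ} (hs : s ∈ Ioo 0 r) :
    ∫⁻ t in Ioo 0 r, f t = (∫⁻ t in Ioo 0 s, f t) + ∫⁻ t in Ioo s r, f t := by
  rw [← Ioo_union_Ico_eq_Ioo hs.1 hs.2.le, lintegral_union measurableSet_Ico
    (Set.disjoint_left.2 fun t h1 h2 => (h1.2.trans_le h2.1).false),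
    setLIntegral_congr Ioo_ae_eq_Ico.symm]

/-- Comparison of a minimizer with the competitor frozen at the value `φ s` on `(0, s)`. -/
lemma energy_add_le_of_freeze {K N p r : ℝ} (hN : 1 < N) (hp : 1 < p) (hr : 0 < r)
    (hrD : 0 < K → r < π * Real.sqrt ((N - 1) / K)) {φ dφ : ℝ → ℝ}
    (hadm : IsAdmissible K N p r φ dφ) (hmin : rayleighQuot K N p r φ dφ = lambdaP K N p r)
    {s : ℝ} (hs : s ∈ Ioo 0 r) (hφs : 0 < φ s) :
    (∫ t in Ioo 0 s, |dφ t| ^ p * modelDensity K N t) +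
        (lambdaP K N p r).toReal * ∫ t in Ioo 0 s, |φ s| ^ p * modelDensity K N t ≤
      (lambdaP K N p r).toReal * ∫ t in Ioo 0 s, |φ t| ^ p * modelDensity K N t := by
  have hp0 : 0 < p := by linarith
  have hc := continuous_modelDensity hN hrD
  have hsub : Ioo 0 s ⊆ Ioo 0 r := Ioo_subset_Ioo_right hs.2.le
  have hlam := (lambdaP_lt_top hN hp hr hrD).ne
  have hpos : ∀ t ∈ Ioo 0 s, 0 < modelDensity K N t := fun t ht =>
    modelDensity_pos hN hrD (hsub ht)
  have hE := lintegral_energy_eq hadm hmin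
  rw [setLIntegral_Ioo_eq_add _ hs, setLIntegral_Ioo_eq_add _ hs] at hE
  have hMtop := hadm.2.2.1
  rw [setLIntegral_Ioo_eq_add _ hs, ENNReal.add_lt_top] at hMtop
  have hA : ∫⁻ t in Ioo 0 s, ENNReal.ofReal (|φ (max t s)| ^ p * modelDensity K N t) =
      ∫⁻ t in Ioo 0 s, ENNReal.ofReal (|φ s| ^ p * modelDensity K N t) :=
    setLIntegral_congr_fun measurableSet_Ioo fun t ht => by simp [max_eq_right ht.2.le]
  have hB : ∫⁻ t in Ioo s r, ENNReal.ofReal (|φ (max t s)| ^ p * modelDensity K N t) =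
      ∫⁻ t in Ioo s r, ENNReal.ofReal (|φ t| ^ p * modelDensity K N t) :=
    setLIntegral_congr_fun measurableSet_Ioo fun t ht => by simp [max_eq_left ht.1.le]
  have hA0 : 0 < ∫⁻ t in Ioo 0 s, ENNReal.ofReal (|φ s| ^ p * modelDensity K N t) := by
    refine setLIntegral_ofReal_Ioo_pos hs.1 (continuous_const.mul hc).continuousOn fun t ht => ?_
    have := hpos t ht
    have := abs_pos.2 hφs.ne'
    positivity
  have hAtop := lintegral_ofReal_lt_top_of_continuous
    ((continuous_const (y := |φ s| ^ p)).mul hc) 0 s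
  have hM' := setLIntegral_Ioo_eq_add
    (fun t => ENNReal.ofReal (|φ (max t s)| ^ p * modelDensity K N t)) hs
  rw [hA, hB] at hM'
  have hadm' : IsAdmissible K N p r (fun t => φ (max t s)) ((Ioi s).indicator dφ) := by
    refine ⟨hadm.1.comp_max s, ?_, ?_, hadm.2.2.2.congr' ?_⟩
    · rw [hM']; exact hA0.trans_le le_self_add
    · rw [hM']; exact ENNReal.add_lt_top.2 ⟨hAtop, hMtop.2⟩
    · filter_upwards [Ioo_mem_nhdsLT hs.2] with t ht
      rw [max_eq_left ht.1.le]
  have hle := lambdaP_le hadm'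
  have hE' : ∫⁻ t in Ioo 0 r, ENNReal.ofReal (|(Ioi s).indicator dφ t| ^ p * modelDensity K N t) =
      ∫⁻ t in Ioo s r, ENNReal.ofReal (|dφ t| ^ p * modelDensity K N t) := by
    rw [setLIntegral_Ioo_eq_add _ hs, setLIntegral_congr_fun (g := fun _ => 0) measurableSet_Ioo,
      lintegral_zero, zero_add]
    · exact setLIntegral_congr_fun measurableSet_Ioo fun t ht => by simp [indicator, ht.1]
    · intro t ht
      simp [indicator, ht.2.not_gt, Real.zero_rpow hp0.ne']
  rw [rayleighQuot, hE', hM', ENNReal.le_div_iff_mul_le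
    (Or.inl (hA0.trans_le le_self_add).ne') (Or.inl (ENNReal.add_lt_top.2 ⟨hAtop, hMtop.2⟩).ne),
    mul_add] at hle
  rw [mul_add] at hE
  have hfin : lambdaP K N p r *
      ∫⁻ t in Ioo s r, ENNReal.ofReal (|φ t| ^ p * modelDensity K N t) ≠ ⊤ :=
    ENNReal.mul_ne_top hlam hMtop.2.ne
  have key : (∫⁻ t in Ioo 0 s, ENNReal.ofReal (|dφ t| ^ p * modelDensity K N t)) +
      lambdaP K N p r * (∫⁻ t in Ioo 0 s, ENNReal.ofReal (|φ s| ^ p * modelDensity K N t)) ≤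
      lambdaP K N p r * ∫⁻ t in Ioo 0 s, ENNReal.ofReal (|φ t| ^ p * modelDensity K N t) := by
    refine (ENNReal.add_le_add_iff_right hfin).1 ?_
    rw [← hE, add_assoc]
    gcongr
  have hint1 := (integrableOn_energy hN hp hr hrD hadm hmin).mono_set hsub
  have hint2 := (integrableOn_mass hN hp hrD hadm).mono_set hsub
  have hint3 : IntegrableOn (fun t => |φ s| ^ p * modelDensity K N t) (Ioo 0 s) :=
    ((continuous_const.mul hc).integrableOn_Icc (a := 0) (b := s)).mono_set Ioo_subset_Icc_self
  have hnn : ∀ u : ℝ → ℝ, 0 ≤ᵐ[volume.restrict (Ioo 0 s)]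
      fun t => |u t| ^ p * modelDensity K N t := fun u => by
    filter_upwards [ae_restrict_mem measurableSet_Ioo] with t ht
    have := hpos t ht
    positivity
  rw [← ofReal_integral_eq_lintegral_ofReal hint1 (hnn dφ),
    ← ofReal_integral_eq_lintegral_ofReal hint2 (hnn φ),
    ← ofReal_integral_eq_lintegral_ofReal hint3 (hnn fun _ => φ s),
    ← ENNReal.ofReal_toReal hlam, ← ENNReal.ofReal_mul ENNReal.toReal_nonneg,
    ← ENNReal.ofReal_mul ENNReal.toReal_nonneg,
    ← ENNReal.ofReal_add (integral_nonneg_of_ae (hnn dφ))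
      (mul_nonneg ENNReal.toReal_nonneg (integral_nonneg_of_ae (hnn fun _ => φ s))),
    ENNReal.ofReal_le_ofReal_iff
      (mul_nonneg ENNReal.toReal_nonneg (integral_nonneg_of_ae (hnn φ)))] at key
  simpa using key

lemma IsLocAC.sub_eq_setIntegral {r : ℝ} {φ dφ : ℝ → ℝ} (h : IsLocAC r φ dφ) {s t : ℝ}
    (hs : 0 < s) (hst : s ≤ t) (ht : t < r) : φ t - φ s = ∫ u in Ioo s t, dφ u := by
  rw [h.2 s t hs hst ht, add_sub_cancel_left, intervalIntegral.integral_of_le hst,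
    integral_Ioc_eq_integral_Ioo]

lemma IsLocAC.integrableOn_Ioo {r : ℝ} {φ dφ : ℝ → ℝ} (h : IsLocAC r φ dφ) {s t : ℝ}
    (hs : 0 < s) (ht : t < r) : IntegrableOn dφ (Ioo s t) :=
  (h.1.integrableOn_compact_subset (Icc_subset_Ioo hs ht) isCompact_Icc).mono_set
    Ioo_subset_Icc_self

lemma abs_rpow_sub_two_mul_self_of_nonneg {q x : ℝ} (hq : 1 < q) (hx : 0 ≤ x) :
    |x| ^ (q - 2) * x = x ^ (q - 1) := by
  rcases hx.eq_or_lt with rfl | hx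
  · simp [Real.zero_rpow (by linarith : q - 1 ≠ 0)]
  · rw [abs_of_pos hx, ← Real.rpow_add_one hx.ne']
    congr 1; ring

lemma abs_rpow_sub_two_mul_self_abs {q x : ℝ} (hq : 1 < q) :
    |(|x| ^ (q - 2) * x)| = |x| ^ (q - 1) := by
  rw [abs_mul, abs_of_nonneg (by positivity), ← abs_rpow_sub_two_mul_self_of_nonneg hq
    (abs_nonneg x), abs_abs]

lemma pos_of_abs_rpow_mul_pos {q x : ℝ} (h : 0 < |x| ^ q * x) : 0 < x := by
  by_contra! hx
  exact h.not_ge (mul_nonpos_of_nonneg_of_nonpos (by positivity) hx)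

lemma neg_of_abs_rpow_mul_neg {q x : ℝ} (h : |x| ^ q * x < 0) : x < 0 := by
  by_contra! hx
  exact h.not_ge (by positivity)

lemma nonpos_of_abs_rpow_mul_nonpos {q x : ℝ} (h : |x| ^ q * x ≤ 0) : x ≤ 0 := by
  by_contra! hx
  exact h.not_gt (mul_pos (Real.rpow_pos_of_pos (abs_pos.2 hx.ne') _) hx)

lemma rpow_sub_rpow_le {q x y : ℝ} (hq : 1 ≤ q) (hy : 0 ≤ y) (hxy : y ≤ x) :
    x ^ q - y ^ q ≤ q * x ^ (q - 1) * (x - y) := by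
  rcases (hy.trans hxy).eq_or_lt with hx | hx
  · have : y = x := by linarith
    simp [this]
  · have h1 := one_add_mul_self_le_rpow_one_add (s := y / x - 1)
      (by have : 0 ≤ y / x := by positivity
          linarith) hq
    rw [add_sub_cancel, Real.div_rpow hy hx.le, le_div_iff₀ (by positivity)] at h1
    have h2 : x ^ q = x ^ (q - 1) * x := by
      rw [← Real.rpow_add_one hx.ne']; congr 1; ring
    have h3 : (1 + q * (y / x - 1)) * x ^ q = x ^ q - q * x ^ (q - 1) * (x - y) := by
      rw [h2]; field_simp; ring
    linarith

/-- The flux identity `(h w)' = -λ h φ ^ (p - 1)` in integrated form. -/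
lemma flux_sub_eq {K N p r : ℝ} (hN : 1 < N) (hp : 1 < p)
    (hrD : 0 < K → r < π * Real.sqrt ((N - 1) / K)) {φ w dw : ℝ → ℝ} {l : ℝ}
    (hnonneg : ∀ t ∈ Ioo 0 r, 0 ≤ φ t) (hw : IsLocAC r w dw)
    (hODE : ∀ᵐ t : ℝ ∂volume, t ∈ Ioo 0 r →
      dw t + w t * (deriv (modelDensity K N) t / modelDensity K N t) =
        -l * |φ t| ^ (p - 2) * φ t)
    {s t : ℝ} (hs : 0 < s) (hst : s ≤ t) (ht : t < r) :
    modelDensity K N t * w t - modelDensity K N s * w s =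
      -(l * ∫ u in Ioo s t, modelDensity K N u * φ u ^ (p - 1)) := by
  rw [← hw.integral_deriv_mul_add (contDiffOn_modelDensity hN hrD) hs hst ht,
    intervalIntegral.integral_of_le hst, integral_Ioc_eq_integral_Ioo,
    ← MeasureTheory.integral_const_mul, ← integral_neg]
  refine setIntegral_congr_ae measurableSet_Ioo ?_
  filter_upwards [hODE] with u hu huI
  have huI' : u ∈ Ioo 0 r := Ioo_subset_Ioo hs.le ht.le huI
  have hpos := modelDensity_pos hN hrD huI'
  have h1 := hu huI'
  rw [mul_assoc, abs_rpow_sub_two_mul_self_of_nonneg hp (hnonneg u huI')] at h1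
  have h2 : deriv (modelDensity K N) u * w u + modelDensity K N u * dw u =
      modelDensity K N u *
        (dw u + w u * (deriv (modelDensity K N) u / modelDensity K N u)) := by
    field_simp; ring
  rw [h2, h1]; ring

lemma flux_antitoneOn {K N p r : ℝ} (hN : 1 < N) (hp : 1 < p)
    (hrD : 0 < K → r < π * Real.sqrt ((N - 1) / K)) {φ w dw : ℝ → ℝ} {l : ℝ} (hl : 0 ≤ l)
    (hnonneg : ∀ t ∈ Ioo 0 r, 0 ≤ φ t) (hw : IsLocAC r w dw)
    (hODE : ∀ᵐ t : ℝ ∂volume, t ∈ Ioo 0 r →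
      dw t + w t * (deriv (modelDensity K N) t / modelDensity K N t) =
        -l * |φ t| ^ (p - 2) * φ t) :
    AntitoneOn (fun t => modelDensity K N t * w t) (Ioo 0 r) := by
  intro s hs t ht hst
  have h1 := flux_sub_eq hN hp hrD hnonneg hw hODE hs.1 hst ht.2
  have h2 : 0 ≤ ∫ u in Ioo s t, modelDensity K N u * φ u ^ (p - 1) :=
    setIntegral_nonneg measurableSet_Ioo fun u hu => by
      have huI : u ∈ Ioo 0 r := Ioo_subset_Ioo hs.1.le ht.2.le hu
      have := hnonneg u huI
      have := modelDensity_pos hN hrD huI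
      positivity
  have := mul_nonneg hl h2
  simp only
  linarith

lemma flux_nonpos {K N p r : ℝ} (hN : 1 < N) (hp : 1 < p) (hr : 0 < r)
    (hrD : 0 < K → r < π * Real.sqrt ((N - 1) / K)) {φ dφ w : ℝ → ℝ}
    (hadm : IsAdmissible K N p r φ dφ) (hnonneg : ∀ t ∈ Ioo 0 r, 0 ≤ φ t)
    (hmin : rayleighQuot K N p r φ dφ = lambdaP K N p r)
    (hwrep : ∀ᵐ t : ℝ ∂volume, t ∈ Ioo 0 r → w t = |dφ t| ^ (p - 2) * dφ t)
    (hanti : AntitoneOn (fun t => modelDensity K N t * w t) (Ioo 0 r)) :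
    ∀ s ∈ Ioo 0 r, w s ≤ 0 := by
  intro s hs
  by_contra! hws
  have hp0 : 0 < p := by linarith
  have hsub : Ioo 0 s ⊆ Ioo 0 r := Ioo_subset_Ioo_right hs.2.le
  have hw : ∀ t ∈ Ioo 0 s, 0 < w t := fun t ht => by
    have h1 := hanti (hsub ht) hs ht.2.le
    exact pos_of_mul_pos_right ((mul_pos (modelDensity_pos hN hrD hs) hws).trans_le h1)
      (modelDensity_pos hN hrD (hsub ht)).le
  have hd : ∀ᵐ t, t ∈ Ioo 0 s → 0 < dφ t := by
    filter_upwards [hwrep] with t ht htI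
    exact pos_of_abs_rpow_mul_pos (ht (hsub htI) ▸ hw t htI)
  have hlt : ∀ t ∈ Ioo 0 s, φ t < φ s := fun t ht => by
    have h1 := hadm.1.sub_eq_setIntegral ht.1 ht.2.le hs.2
    have h2 := setIntegral_Ioo_pos ht.2 (hadm.1.integrableOn_Ioo ht.1 hs.2)
      (hd.mono fun u hu huI => hu (Ioo_subset_Ioo_left ht.1.le huI))
    linarith
  have hhalf : s / 2 ∈ Ioo 0 s := ⟨by linarith [hs.1], by linarith [hs.1]⟩
  have hφs : 0 < φ s := (hnonneg _ (hsub hhalf)).trans_lt (hlt _ hhalf)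
  have key := energy_add_le_of_freeze hN hp hr hrD hadm hmin hs hφs
  have hE : 0 < ∫ t in Ioo 0 s, |dφ t| ^ p * modelDensity K N t := by
    refine setIntegral_Ioo_pos hs.1
      ((integrableOn_energy hN hp hr hrD hadm hmin).mono_set hsub) ?_
    filter_upwards [hd] with t ht htI
    have := modelDensity_pos hN hrD (hsub htI)
    have := abs_pos.2 (ht htI).ne'
    positivity
  have hM : ∫ t in Ioo 0 s, |φ t| ^ p * modelDensity K N t ≤
      ∫ t in Ioo 0 s, |φ s| ^ p * modelDensity K N t := by
    refine setIntegral_mono_on ((integrableOn_mass hN hp hrD hadm).mono_set hsub)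
      (((continuous_const.mul (continuous_modelDensity hN hrD)).integrableOn_Icc
        (a := 0) (b := s)).mono_set Ioo_subset_Icc_self) measurableSet_Ioo fun t ht => ?_
    have := modelDensity_pos hN hrD (hsub ht)
    have h0 := hnonneg t (hsub ht)
    gcongr
    exact (hlt t ht).le
  have := mul_le_mul_of_nonneg_left hM (ENNReal.toReal_nonneg (a := lambdaP K N p r))
  linarith

lemma antitoneOn_of_flux_nonpos {p r : ℝ} {φ dφ w : ℝ → ℝ} (hφ : IsLocAC r φ dφ)
    (hwrep : ∀ᵐ t : ℝ ∂volume, t ∈ Ioo 0 r → w t = |dφ t| ^ (p - 2) * dφ t)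
    (hw : ∀ s ∈ Ioo 0 r, w s ≤ 0) : AntitoneOn φ (Ioo 0 r) := by
  intro s hs t ht hst
  have h1 := hφ.sub_eq_setIntegral hs.1 hst ht.2
  have h2 : ∫ u in Ioo s t, dφ u ≤ 0 := by
    refine integral_nonpos_of_ae ((ae_restrict_iff' measurableSet_Ioo).2 ?_)
    filter_upwards [hwrep] with u hu huI
    have huI' : u ∈ Ioo 0 r := Ioo_subset_Ioo hs.1.le ht.2.le huI
    exact nonpos_of_abs_rpow_mul_nonpos (hu huI' ▸ hw u huI')
  linarith

lemma integral_rpow_sub_le {p s B H e : ℝ} {h φ : ℝ → ℝ} (hp : 1 ≤ p) (hs : 0 ≤ s) (hB : 0 ≤ B)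
    (he : 0 ≤ e) (hi₁ : IntegrableOn (fun t => |φ t| ^ p * h t) (Ioo 0 s))
    (hi₂ : IntegrableOn (fun t => |φ s| ^ p * h t) (Ioo 0 s))
    (hφ : ∀ t ∈ Ioo 0 s, 0 ≤ h t ∧ h t ≤ H ∧ 0 ≤ φ s ∧ φ s ≤ φ t ∧ φ t - φ s ≤ e ∧ φ t ≤ B) :
    (∫ t in Ioo 0 s, |φ t| ^ p * h t) - ∫ t in Ioo 0 s, |φ s| ^ p * h t ≤
      s * (p * B ^ (p - 1) * e * H) := by
  have h1 : (∫ t in Ioo 0 s, |φ t| ^ p * h t) - ∫ t in Ioo 0 s, |φ s| ^ p * h t ≤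
      ∫ _ in Ioo 0 s, p * B ^ (p - 1) * e * H := by
    rw [← integral_sub hi₁ hi₂]
    refine setIntegral_mono_on (hi₁.sub hi₂) (integrableOn_const (by simp)) measurableSet_Ioo
      fun t ht => ?_
    obtain ⟨hh, hH, hφs, hle, hosc, hφB⟩ := hφ t ht
    have hφt := hφs.trans hle
    rw [← sub_mul, abs_of_nonneg hφt, abs_of_nonneg hφs]
    have h2 := rpow_sub_rpow_le hp hφs hle
    have h3 : φ t ^ (p - 1) ≤ B ^ (p - 1) := Real.rpow_le_rpow hφt hφB (by linarith)
    have h4 : p * φ t ^ (p - 1) * (φ t - φ s) ≤ p * B ^ (p - 1) * e :=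
      mul_le_mul (mul_le_mul_of_nonneg_left h3 (by linarith)) hosc (by linarith) (by positivity)
    exact mul_le_mul (h2.trans h4) hH hh (by positivity)
  rwa [setIntegral_const, Measure.real, Real.volume_Ioo, sub_zero, ENNReal.toReal_ofReal hs,
    smul_eq_mul] at h1

/-- The natural boundary condition: the flux `h w` cannot stay away from `0` near the origin. -/
lemma exists_neg_lt_flux {K N p r : ℝ} (hN : 1 < N) (hp : 1 < p) (hr : 0 < r)
    (hrD : 0 < K → r < π * Real.sqrt ((N - 1) / K)) {φ dφ w : ℝ → ℝ}
    (hadm : IsAdmissible K N p r φ dφ) (hnonneg : ∀ t ∈ Ioo 0 r, 0 ≤ φ t)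
    (hmin : rayleighQuot K N p r φ dφ = lambdaP K N p r)
    (hwrep : ∀ᵐ t : ℝ ∂volume, t ∈ Ioo 0 r → w t = |dφ t| ^ (p - 2) * dφ t)
    {c : ℝ} (hc : 0 < c) : ∃ s ∈ Ioo 0 r, -c < modelDensity K N s * w s := by
  by_contra! hflux
  have hp0 : 0 < p := by linarith
  have hpos : ∀ t ∈ Ioo 0 r, 0 < modelDensity K N t := fun t ht => modelDensity_pos hN hrD ht
  have hcont := continuous_modelDensity hN hrD
  have hw : ∀ t ∈ Ioo 0 r, w t < 0 := fun t ht => by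
    by_contra! h0
    have := mul_nonneg (hpos t ht).le h0
    linarith [hflux t ht]
  have hd : ∀ᵐ t, t ∈ Ioo 0 r → dφ t < 0 := by
    filter_upwards [hwrep] with t ht htI
    exact neg_of_abs_rpow_mul_neg (ht htI ▸ hw t htI)
  have hanti : ∀ s t, 0 < s → s < t → t < r → φ t < φ s := fun s t hs hst ht => by
    have h1 := hadm.1.sub_eq_setIntegral hs hst.le ht
    have h2 := setIntegral_Ioo_pos hst (hadm.1.integrableOn_Ioo hs ht).neg
      (hd.mono fun u hu huI => neg_pos.2 (hu (Ioo_subset_Ioo hs.le ht.le huI)))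
    simp only [Pi.neg_apply, integral_neg] at h2
    linarith
  have hφpos : ∀ s ∈ Ioo 0 r, 0 < φ s := fun s hs =>
    (hnonneg ((s + r) / 2) ⟨by linarith [hs.1, hs.2], by linarith [hs.2]⟩).trans_lt
      (hanti _ _ hs.1 (by linarith [hs.2]) (by linarith [hs.2]))
  set E : ℝ → ℝ := fun s => ∫ t in Ioo 0 s, |dφ t| ^ p * modelDensity K N t with hEdef
  have hEint := integrableOn_energy hN hp hr hrD hadm hmin
  have hEpos : ∀ s ∈ Ioo 0 r, 0 < E s := fun s hs => by
    have hsub : Ioo 0 s ⊆ Ioo 0 r := Ioo_subset_Ioo_right hs.2.le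
    refine setIntegral_Ioo_pos hs.1 (hEint.mono_set hsub) ?_
    filter_upwards [hd] with t ht htI
    have := hpos t (hsub htI)
    have := abs_pos.2 (ht (hsub htI)).ne
    positivity
  have hosc : ∀ s ∈ Ioo 0 r, ∀ t ∈ Ioo 0 s, φ t - φ s ≤ E s / c := fun s hs t ht => by
    have hsub : Ioo 0 s ⊆ Ioo 0 r := Ioo_subset_Ioo_right hs.2.le
    have hsub' : Ioo t s ⊆ Ioo 0 s := Ioo_subset_Ioo_left ht.1.le
    have h1 := hadm.1.sub_eq_setIntegral ht.1 ht.2.le hs.2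
    have h2 : ∫ u in Ioo t s, -(c * dφ u) ≤
        ∫ u in Ioo t s, |dφ u| ^ p * modelDensity K N u := by
      refine setIntegral_mono_on_ae ((hadm.1.integrableOn_Ioo ht.1 hs.2).const_mul c).neg
        (hEint.mono_set (hsub'.trans hsub)) measurableSet_Ioo ?_
      filter_upwards [hd, hwrep] with u hu hwu huI
      have huI' := hsub (hsub' huI)
      have hdu := hu huI'
      have hfl := hflux u huI'
      have habs : |dφ u| = -dφ u := abs_of_neg hdu
      have hpw : |dφ u| ^ p = -(w u * |dφ u|) := by
        rw [hwu huI', show p = (p - 2) + 1 + 1 by ring, Real.rpow_add_one (abs_pos.2 hdu.ne).ne',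
          Real.rpow_add_one (abs_pos.2 hdu.ne).ne']
        rw [show p - 2 + 1 + 1 - 2 = p - 2 by ring, habs]
        ring
      rw [hpw, habs]
      nlinarith
    have h3 : ∫ u in Ioo t s, |dφ u| ^ p * modelDensity K N u ≤ E s := by
      refine setIntegral_mono_set (hEint.mono_set hsub) ?_ hsub'.eventuallyLE
      filter_upwards [ae_restrict_mem measurableSet_Ioo] with u hu
      have := hpos u (hsub hu)
      positivity
    rw [integral_neg, MeasureTheory.integral_const_mul, ← h1] at h2
    rw [le_div_iff₀ hc]
    linarith
  have hr2 : r / 2 ∈ Ioo 0 r := ⟨by linarith, by linarith⟩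
  set B := φ (r / 2) + E (r / 2) / c with hB
  have hB0 : 0 < B := add_pos (hφpos _ hr2) (div_pos (hEpos _ hr2) hc)
  have hφB : ∀ t ∈ Ioo 0 (r / 2), φ t ≤ B := fun t ht => by linarith [hosc _ hr2 t ht]
  obtain ⟨H, hH⟩ := isCompact_Icc.exists_bound_of_continuousOn
    (hcont.continuousOn (s := Icc 0 r))
  have hH' : ∀ t ∈ Ioo 0 r, modelDensity K N t ≤ H := fun t ht =>
    (le_abs_self _).trans (hH t (Ioo_subset_Icc_self ht))
  have hl := ENNReal.toReal_nonneg (a := lambdaP K N p r)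
  set l := (lambdaP K N p r).toReal
  have hmain : ∀ s ∈ Ioo 0 (r / 2), c ≤ l * (p * B ^ (p - 1) * H) * s := fun s hs => by
    have hsr : s ∈ Ioo 0 r := ⟨hs.1, by linarith [hs.2]⟩
    have hsub : Ioo 0 s ⊆ Ioo 0 r := Ioo_subset_Ioo_right hsr.2.le
    have key := energy_add_le_of_freeze hN hp hr hrD hadm hmin hsr (hφpos s hsr)
    have hi1 := (integrableOn_mass hN hp hrD hadm).mono_set hsub
    have hi2 : IntegrableOn (fun t => |φ s| ^ p * modelDensity K N t) (Ioo 0 s) :=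
      ((continuous_const.mul hcont).integrableOn_Icc (a := 0) (b := s)).mono_set
        Ioo_subset_Icc_self
    have h1 := integral_rpow_sub_le hp.le hs.1.le hB0.le (div_pos (hEpos s hsr) hc).le hi1 hi2
      fun t ht => ⟨(hpos t (hsub ht)).le, hH' t (hsub ht), (hφpos s hsr).le,
        (hanti t s ht.1 ht.2 hsr.2).le, hosc s hsr t ht, hφB t ⟨ht.1, ht.2.trans hs.2⟩⟩
    have h2 := mul_le_mul_of_nonneg_left h1 hl
    have h3 : E s ≤ E s * (l * (p * B ^ (p - 1) * H) * s / c) := by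
      calc E s ≤ l * (s * (p * B ^ (p - 1) * (E s / c) * H)) := by
            simp only [hEdef] at h2 ⊢
            linarith
        _ = _ := by ring
    have h4 := le_of_mul_le_mul_left ((mul_one (E s)).le.trans h3) (hEpos s hsr)
    rwa [le_div_iff₀ hc, one_mul] at h4
  have hlim : Tendsto (fun s : ℝ => l * (p * B ^ (p - 1) * H) * s) (𝓝[>] 0) (𝓝 0) := by
    have : Tendsto (fun s : ℝ => l * (p * B ^ (p - 1) * H) * s) (𝓝 0)
        (𝓝 (l * (p * B ^ (p - 1) * H) * 0)) := (continuous_const.mul continuous_id).tendsto 0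
    rw [mul_zero] at this
    exact this.mono_left nhdsWithin_le_nhds
  have := ge_of_tendsto hlim (by
    filter_upwards [Ioo_mem_nhdsGT hr2.1] with s hs using hmain s hs)
  linarith

lemma flux_lower_bound {N p r s₀ c₁ c₂ l C a : ℝ} {h φ w : ℝ → ℝ} (hp : 1 < p)
    (hs₀ : s₀ ∈ Ioo 0 r) (hc₁ : 0 < c₁) (hc₂ : 0 < c₂) (hl : 0 ≤ l) (hC : 0 ≤ C)
    (hh : ∀ t ∈ Ioc 0 s₀, c₁ * t ^ (N - 1) ≤ h t ∧ h t ≤ c₂ * t ^ (N - 1))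
    (hcont : ContinuousOn h (Ioo 0 r)) (hφc : ContinuousOn φ (Ioo 0 r))
    (hnonneg : ∀ t ∈ Ioo 0 r, 0 ≤ φ t)
    (hwneg : ∀ t ∈ Ioo 0 r, w t ≤ 0)
    (hanti : AntitoneOn (fun t => h t * w t) (Ioo 0 r))
    (hflux : ∀ s t, 0 < s → s ≤ t → t < r →
      h t * w t - h s * w s = -(l * ∫ u in Ioo s t, h u * φ u ^ (p - 1)))
    (hzero : ∀ c > 0, ∃ s ∈ Ioo 0 r, -c < h s * w s)
    (haN : a * (p - 1) < N) (hφ : ∀ t ∈ Ioc 0 s₀, φ t ≤ C * t ^ (-a)) :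
    ∃ C' : ℝ, 0 ≤ C' ∧ ∀ t ∈ Ioc 0 s₀, |w t| ≤ C' * t ^ (1 - a * (p - 1)) := by
  set b := N - a * (p - 1) with hb
  have hb0 : 0 < b := by linarith
  set D := l * (c₂ * C ^ (p - 1) / b) with hD
  have hD0 : 0 ≤ D := by positivity
  have hIoc : Ioc 0 s₀ ⊆ Ioo 0 r := fun t ht => ⟨ht.1, ht.2.trans_lt hs₀.2⟩
  have step : ∀ s t, 0 < s → s ≤ t → t ≤ s₀ → -(h t * w t) ≤ -(h s * w s) + D * t ^ b := by
    intro s t hs hst ht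
    have h1 := hflux s t hs hst (ht.trans_lt hs₀.2)
    have hsubI : Icc s t ⊆ Ioo 0 r := Icc_subset_Ioo hs (ht.trans_lt hs₀.2)
    have hci : ContinuousOn (fun u : ℝ => c₂ * C ^ (p - 1) * u ^ (b - 1)) (Icc s t) :=
      continuousOn_const.mul (continuousOn_id.rpow_const fun u hu => Or.inl (hs.trans_le hu.1).ne')
    have h2 : ∫ u in Ioo s t, h u * φ u ^ (p - 1) ≤
        ∫ u in Ioo s t, c₂ * C ^ (p - 1) * u ^ (b - 1) := by
      refine setIntegral_mono_on
        ((((hcont.mono hsubI).mul ((hφc.mono hsubI).rpow_const fun _ _ =>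
          Or.inr (by linarith))).integrableOn_Icc).mono_set Ioo_subset_Icc_self)
        (hci.integrableOn_Icc.mono_set Ioo_subset_Icc_self) measurableSet_Ioo fun u hu => ?_
      have hu0 : 0 < u := hs.trans hu.1
      have huI : u ∈ Ioc 0 s₀ := ⟨hu0, hu.2.le.trans ht⟩
      have hφu := hnonneg u (hIoc huI)
      have h3 : φ u ^ (p - 1) ≤ (C * u ^ (-a)) ^ (p - 1) :=
        Real.rpow_le_rpow hφu (hφ u huI) (by linarith)
      have h4 : (c₂ * u ^ (N - 1)) * (C * u ^ (-a)) ^ (p - 1) =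
          c₂ * C ^ (p - 1) * u ^ (b - 1) := by
        rw [Real.mul_rpow hC (by positivity), ← Real.rpow_mul hu0.le,
          show b - 1 = (N - 1) + -a * (p - 1) by rw [hb]; ring, Real.rpow_add hu0]
        ring
      rw [← h4]
      exact mul_le_mul (hh u huI).2 h3 (by positivity) (by positivity)
    have h5 : ∫ u in Ioo s t, c₂ * C ^ (p - 1) * u ^ (b - 1) ≤ c₂ * C ^ (p - 1) / b * t ^ b := by
      rw [MeasureTheory.integral_const_mul, ← integral_Ioc_eq_integral_Ioo,
        ← intervalIntegral.integral_of_le hst, integral_rpow (Or.inl (by linarith)),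
        sub_add_cancel]
      have : 0 ≤ s ^ b := by positivity
      rw [div_mul_eq_mul_div, mul_div_assoc]
      gcongr
      linarith
    have h6 := mul_le_mul_of_nonneg_left (h2.trans h5) hl
    rw [← mul_assoc, ← hD] at h6
    linarith
  have bound : ∀ t ∈ Ioc 0 s₀, -(h t * w t) ≤ D * t ^ b := fun t ht => by
    refine le_of_forall_pos_le_add fun ε hε => ?_
    obtain ⟨s, hs, hsε⟩ := hzero ε hε
    have hm : 0 < min s t := lt_min hs.1 ht.1
    have h1 := step (min s t) t hm (min_le_right _ _) ht.2
    have h2 := hanti ⟨hm, (min_le_left _ _).trans_lt hs.2⟩ hs (min_le_left s t)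
    simp only at h2
    linarith
  refine ⟨D / c₁, by positivity, fun t ht => ?_⟩
  have ht0 : 0 < t := ht.1
  rw [abs_of_nonpos (hwneg t (hIoc ht))]
  have hw0 : 0 ≤ -w t := neg_nonneg.2 (hwneg t (hIoc ht))
  have h1 : c₁ * t ^ (N - 1) * -w t ≤ D * t ^ b :=
    (mul_le_mul_of_nonneg_right (hh t ht).1 hw0).trans (by linarith [bound t ht])
  have h2 : t ^ b = t ^ (1 - a * (p - 1)) * t ^ (N - 1) := by
    rw [← Real.rpow_add ht0]; congr 1; rw [hb]; ring
  rw [h2] at h1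
  have h3 : 0 < t ^ (N - 1) := by positivity
  rw [div_mul_eq_mul_div, le_div_iff₀ hc₁]
  refine le_of_mul_le_mul_right ?_ h3
  linarith

/-- A bound on `w` improves the growth exponent of `φ` at the origin by `1 / (p - 1)`. -/
lemma growth_of_flux_bound {p r s₀ C a a' : ℝ} {φ dφ w : ℝ → ℝ} (hp : 1 < p)
    (hs₀ : s₀ ∈ Ioo 0 r) (hs₁ : s₀ ≤ 1) (hC : 0 ≤ C) (ha' : 0 ≤ a') (haa' : a - 1 / (p - 1) ≤ a')
    (hφ : IsLocAC r φ dφ) (hnonneg : ∀ t ∈ Ioo 0 r, 0 ≤ φ t)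
    (hwrep : ∀ᵐ t : ℝ ∂volume, t ∈ Ioo 0 r → w t = |dφ t| ^ (p - 2) * dφ t)
    (hw : ∀ t ∈ Ioc 0 s₀, |w t| ≤ C * t ^ (1 - a * (p - 1))) :
    ∃ C' : ℝ, 0 ≤ C' ∧ ∀ t ∈ Ioc 0 s₀, φ t ≤ C' * t ^ (-a') := by
  have hp1 : 0 < p - 1 := by linarith
  set D := C ^ (1 / (p - 1)) with hD
  have hD0 : 0 ≤ D := by positivity
  have hφs := hnonneg s₀ hs₀
  refine ⟨φ s₀ + D, by positivity, fun t ht => ?_⟩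
  have ht0 : 0 < t := ht.1
  have h1 := hφ.sub_eq_setIntegral ht.1 ht.2 hs₀.2
  have h2 : ‖∫ u in Ioo t s₀, dφ u‖ ≤ D * t ^ (-a') * volume.real (Ioo t s₀) := by
    refine norm_setIntegral_le_of_norm_le_const_ae' (by simp) ?_
    filter_upwards [hwrep] with u hu huI
    have hu0 : 0 < u := ht0.trans huI.1
    have hwu := hw u ⟨hu0, huI.2.le⟩
    rw [hu ⟨hu0, huI.2.trans hs₀.2⟩, abs_rpow_sub_two_mul_self_abs hp] at hwu
    have h3 := Real.rpow_le_rpow (by positivity) hwu (by positivity : 0 ≤ 1 / (p - 1))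
    rw [← Real.rpow_mul (abs_nonneg _), mul_one_div_cancel hp1.ne', Real.rpow_one,
      Real.mul_rpow hC (by positivity), ← Real.rpow_mul hu0.le] at h3
    rw [Real.norm_eq_abs]
    refine h3.trans (mul_le_mul_of_nonneg_left ?_ hD0)
    calc u ^ ((1 - a * (p - 1)) * (1 / (p - 1))) ≤ u ^ (-a') := by
          refine Real.rpow_le_rpow_of_exponent_ge hu0 (huI.2.le.trans hs₁) ?_
          have : (1 - a * (p - 1)) * (1 / (p - 1)) = 1 / (p - 1) - a := by field_simp
          linarith
      _ ≤ t ^ (-a') := Real.rpow_le_rpow_of_nonpos ht0 huI.1.le (by linarith)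
  have hvol : volume.real (Ioo t s₀) ≤ 1 := by
    rw [Measure.real, Real.volume_Ioo, ENNReal.toReal_ofReal (by linarith [ht.2])]
    linarith
  have h3 : (1 : ℝ) ≤ t ^ (-a') :=
    Real.one_le_rpow_of_pos_of_le_one_of_nonpos ht0 (ht.2.trans hs₁) (by linarith)
  have h4 : D * t ^ (-a') * volume.real (Ioo t s₀) ≤ D * t ^ (-a') :=
    mul_le_of_le_one_right (by positivity) hvol
  rw [← h1, Real.norm_eq_abs] at h2
  have h5 := neg_abs_le (φ s₀ - φ t)
  have h6 : φ s₀ ≤ φ s₀ * t ^ (-a') := le_mul_of_one_le_right hφs h3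
  linarith

/-- Finite mass gives the a priori growth bound `φ t ≤ C t ^ (-N / p)`. -/
lemma growth_of_mass {K N p r s₀ c₁ : ℝ} (hN : 1 < N) (hp : 1 < p)
    (hrD : 0 < K → r < π * Real.sqrt ((N - 1) / K)) {φ dφ : ℝ → ℝ}
    (hadm : IsAdmissible K N p r φ dφ) (hnonneg : ∀ t ∈ Ioo 0 r, 0 ≤ φ t)
    (hφ : AntitoneOn φ (Ioo 0 r)) (hs₀ : s₀ ∈ Ioo 0 r) (hc₁ : 0 < c₁)
    (hh : ∀ t ∈ Ioc 0 s₀, c₁ * t ^ (N - 1) ≤ modelDensity K N t) :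
    ∃ C : ℝ, 0 ≤ C ∧ ∀ t ∈ Ioc 0 s₀, φ t ≤ C * t ^ (-(N / p)) := by
  have hp0 : 0 < p := by linarith
  have hN0 : 0 < N := by linarith
  have hM := integrableOn_mass hN hp hrD hadm
  have hM0 : 0 ≤ᵐ[volume.restrict (Ioo 0 r)] fun t => |φ t| ^ p * modelDensity K N t := by
    filter_upwards [ae_restrict_mem measurableSet_Ioo] with t ht
    have := modelDensity_pos hN hrD ht
    positivity
  set M := ∫ t in Ioo 0 r, |φ t| ^ p * modelDensity K N t
  have hMnn : 0 ≤ M := integral_nonneg_of_ae hM0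
  refine ⟨(M * N / c₁) ^ (1 / p), by positivity, fun t ht => ?_⟩
  have ht0 : 0 < t := ht.1
  have htr : t ∈ Ioo 0 r := ⟨ht0, ht.2.trans_lt hs₀.2⟩
  have hsub : Ioo 0 t ⊆ Ioo 0 r := Ioo_subset_Ioo_right htr.2.le
  have hφt := hnonneg t htr
  have h1 : ∫ u in Ioo 0 t, φ t ^ p * c₁ * u ^ (N - 1) ≤ M := by
    refine le_trans (setIntegral_mono_on ?_ (hM.mono_set hsub) measurableSet_Ioo fun u hu => ?_)
      (setIntegral_mono_set hM hM0 hsub.eventuallyLE)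
    · exact ((continuous_const.mul (continuous_id.rpow_const fun _ =>
        Or.inr (by linarith))).integrableOn_Icc (a := 0) (b := t)).mono_set Ioo_subset_Icc_self
    · have hu0 : 0 < u := hu.1
      have h2 := hφ (hsub hu) htr hu.2.le
      rw [abs_of_nonneg (hnonneg u (hsub hu)), mul_assoc]
      have := hh u ⟨hu0, hu.2.le.trans ht.2⟩
      have hφu : 0 ≤ φ u := hφt.trans h2
      gcongr
  rw [MeasureTheory.integral_const_mul, ← integral_Ioc_eq_integral_Ioo,
    ← intervalIntegral.integral_of_le ht0.le, integral_rpow (Or.inl (by linarith)),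
    sub_add_cancel, Real.zero_rpow hN0.ne', sub_zero] at h1
  have h2 : φ t ^ p ≤ M * N / c₁ * t ^ (-N) := by
    rw [Real.rpow_neg ht0.le, ← div_eq_mul_inv, le_div_iff₀ (by positivity),
      le_div_iff₀ hc₁, ← div_le_iff₀ hN0]
    calc φ t ^ p * t ^ N * c₁ / N = φ t ^ p * c₁ * (t ^ N / N) := by ring
      _ ≤ M := h1
  have h3 := Real.rpow_le_rpow (by positivity) h2 (by positivity : 0 ≤ 1 / p)
  rwa [← Real.rpow_mul hφt, mul_one_div_cancel hp0.ne', Real.rpow_one,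
    Real.mul_rpow (by positivity) (by positivity), ← Real.rpow_mul ht0.le,
    show -N * (1 / p) = -(N / p) by ring] at h3

/-- boundary behavior and monotonicity of the model `p`-eigenfunction.
If `φ` is a nonnegative admissible minimizer of `λ_p(K,N,r)` and `w` is the locally
absolutely continuous representative of `|φ'|^{p−2} φ'` solving the Euler–Lagrange
equation, then `w(t) → 0` as `t ↓ 0` and `φ` is non-increasing on `(0,r)`. -/
theorem model_eigenfunction_nonincreasing
    (K N p r : ℝ) (hN : 1 < N) (hp : 1 < p)
    (hr : 0 < r) (hrD : 0 < K → r < π * Real.sqrt ((N - 1) / K))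
    (φ dφ w dw : ℝ → ℝ)
    (hadm : IsAdmissible K N p r φ dφ)
    (hnonneg : ∀ t ∈ Set.Ioo 0 r, 0 ≤ φ t)
    (hmin : rayleighQuot K N p r φ dφ = lambdaP K N p r)
    (hw : IsLocAC r w dw)
    (hwrep : ∀ᵐ t : ℝ ∂volume, t ∈ Set.Ioo 0 r → w t = |dφ t| ^ (p - 2) * dφ t)
    (hODE : ∀ᵐ t : ℝ ∂volume, t ∈ Set.Ioo 0 r →
      dw t + w t * (deriv (modelDensity K N) t / modelDensity K N t) =
        -(lambdaP K N p r).toReal * |φ t| ^ (p - 2) * φ t) :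
    Filter.Tendsto w (nhdsWithin 0 (Set.Ioi 0)) (nhds 0) ∧
    AntitoneOn φ (Set.Ioo 0 r) := by
  have hl := ENNReal.toReal_nonneg (a := lambdaP K N p r)
  have hanti := flux_antitoneOn hN hp hrD hl hnonneg hw hODE
  have hwneg := flux_nonpos hN hp hr hrD hadm hnonneg hmin hwrep hanti
  have hφanti := antitoneOn_of_flux_nonpos hadm.1 hwrep hwneg
  refine ⟨?_, hφanti⟩
  obtain ⟨s₀, hs₀, hs₁, c₁, c₂, hc₁, hc₂, hh⟩ := exists_modelDensity_bounds hN hr hrD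
  have hp1 : 0 < p - 1 := by linarith
  have hNp : 0 < N / p := div_pos (by linarith) (by linarith)
  have hflux : ∀ C a : ℝ, 0 ≤ C → a * (p - 1) < N → (∀ t ∈ Ioc 0 s₀, φ t ≤ C * t ^ (-a)) →
      ∃ C' : ℝ, 0 ≤ C' ∧ ∀ t ∈ Ioc 0 s₀, |w t| ≤ C' * t ^ (1 - a * (p - 1)) :=
    fun C a hC ha hφa => flux_lower_bound hp hs₀ hc₁ hc₂ hl hC hh
      (continuous_modelDensity hN hrD).continuousOn hadm.1.continuousOn hnonneg hwneg hanti
      (fun s t hs hst ht => flux_sub_eq hN hp hrD hnonneg hw hODE hs hst ht)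
      (fun c hc => exists_neg_lt_flux hN hp hr hrD hadm hnonneg hmin hwrep hc) ha hφa
  have hboot : ∀ n : ℕ, ∃ C : ℝ, 0 ≤ C ∧
      ∀ t ∈ Ioc 0 s₀, φ t ≤ C * t ^ (-(max (N / p - n * (1 / (p - 1))) 0)) := by
    intro n
    induction n with
    | zero =>
      simpa [max_eq_left hNp.le] using
        growth_of_mass hN hp hrD hadm hnonneg hφanti hs₀ hc₁ fun t ht => (hh t ht).1
    | succ n ih =>
      obtain ⟨C, hC, hφC⟩ := ih
      have ha : max (N / p - n * (1 / (p - 1))) 0 ≤ N / p :=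
        max_le (sub_le_self _ (by positivity)) hNp.le
      obtain ⟨C', hC', hwC⟩ := hflux C _ hC ((mul_le_mul_of_nonneg_right ha hp1.le).trans_lt (by
        rw [div_mul_eq_mul_div, div_lt_iff₀ (by linarith)]
        nlinarith)) hφC
      refine growth_of_flux_bound hp hs₀ hs₁ hC' (le_max_right _ _) ?_ hadm.1 hnonneg hwrep hwC
      have : 0 < 1 / (p - 1) := by positivity
      rw [sub_le_iff_le_add]
      refine max_le ?_ (add_nonneg (le_max_right _ _) this.le)
      refine le_trans (le_of_eq ?_) (add_le_add_left (le_max_left _ _) _)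
      push_cast
      ring
  obtain ⟨n, hn⟩ := exists_nat_ge (N / p * (p - 1))
  obtain ⟨C, hC, hφC⟩ := hboot n
  have hexp : max (N / p - n * (1 / (p - 1))) 0 = 0 := by
    refine max_eq_right (sub_nonpos.2 ?_)
    rw [mul_one_div, le_div_iff₀ hp1]
    exact hn
  rw [hexp] at hφC
  obtain ⟨C', hC', hwC⟩ := hflux C 0 hC (by linarith) hφC
  refine squeeze_zero_norm' (a := fun t => C' * t) ?_ ?_
  · filter_upwards [Ioc_mem_nhdsGT hs₀.1] with t ht
    simpa using hwC t ht
  · have : Tendsto (fun t : ℝ => C' * t) (𝓝 0) (𝓝 (C' * 0)) :=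
      (continuous_const.mul continuous_id).tendsto 0
    rw [mul_zero] at this
    exact this.mono_left nhdsWithin_le_nhds
end
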